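/- arXiv:2208.06126 — 4 statements merged into one kernel-verified Lean document; each statement's English description precedes it below -/
import Mathlib

section
/- Let T be a tree on k ≥ 4 vertices with maximum degree Δ(T). Then for every n ≥ k, ex_c(n,T) ≥ ⌊n(Δ(T)−1)/2⌋. -/
open SimpleGraph

/-- `G` contains a copy of `F`, i.e. a subgraph isomorphic to `F`
(given by an injective graph homomorphism). -/
def ContainsCopy {α β : Type*} (F : SimpleGraph α) (G : SimpleGraph β) : Prop :=
  ∃ f : α ↪ β, ∀ ⦃a b : α⦄, F.Adj a b → G.Adj (f a) (f b)

/-- The connected Turán number `ex_c(n, F)`: the maximum number of edges of a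
connected `F`-free simple graph on `n` vertices. -/
noncomputable def exConn {α : Type*} (n : ℕ) (F : SimpleGraph α) : ℕ :=
  sSup {m | ∃ G : SimpleGraph (Fin n), G.Connected ∧ ¬ ContainsCopy F G ∧ m = G.edgeSet.ncard}

theorem le_exConn_of_graph {α : Type*} {n : ℕ} (F : SimpleGraph α) (G : SimpleGraph (Fin n))
    (hc : G.Connected) (hf : ¬ ContainsCopy F G) : G.edgeSet.ncard ≤ exConn n F := by
  classical
  apply le_csSup
  · apply Set.Finite.bddAbove
    apply (Set.finite_range (fun G : SimpleGraph (Fin n) => G.edgeSet.ncard)).subset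
    rintro m ⟨G, _, _, rfl⟩
    exact ⟨G, rfl⟩
  · exact ⟨G, hc, hf, rfl⟩

/-- the star on `Fin n` centred at `z` -/
def myStar {n : ℕ} (z : Fin n) : SimpleGraph (Fin n) where
  Adj a b := a ≠ b ∧ (a = z ∨ b = z)
  symm := ⟨fun a b h => ⟨h.1.symm, h.2.symm⟩⟩
  loopless := ⟨fun a h => h.1 rfl⟩

/-- the near-regular circulant-like graph -/
def circ (n r e : ℕ) : SimpleGraph (Fin n) where
  Adj a b := a.val ≠ b.val ∧
    ((a.val ≤ b.val + r ∧ b.val ≤ a.val + r) ∨ (n ≤ a.val - b.val + r) ∨ (n ≤ b.val - a.val + r) ∨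
      (e = 1 ∧ a.val < n / 2 ∧ b.val = a.val + n / 2) ∨
      (e = 1 ∧ b.val < n / 2 ∧ a.val = b.val + n / 2))
  symm := ⟨fun a b h => by omega⟩
  loopless := ⟨fun a h => h.1 rfl⟩

theorem circ_connected (n r e : ℕ) (hn : 0 < n) (hr : 1 ≤ r) : (circ n r e).Connected := by
  obtain ⟨m, rfl⟩ : ∃ m, n = m + 1 := ⟨n - 1, by omega⟩
  refine (pathGraph_connected m).mono ?_
  intro a b h
  rw [pathGraph_adj] at h
  simp only [circ]
  omega

theorem circ_degree (n r e : ℕ) (he : e ≤ 1) (hn : 2 * r + 2 + e ≤ n) (v : Fin n)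
    (s : Finset (Fin n)) (hs : ∀ w ∈ s, (circ n r e).Adj v w) : s.card ≤ 2 * r + e := by
  classical
  rw [← Finset.card_range (2 * r + e)]
  let δ : Fin n → ℕ := fun w => if v.val ≤ w.val then w.val - v.val else w.val + n - v.val
  apply Finset.card_le_card_of_injOn
    (fun w => if δ w ≤ r then δ w - 1 else if n ≤ δ w + r then n - δ w - 1 + r else 2 * r)
  · intro w hw
    have h := hs w hw
    simp only [circ] at h
    have := v.2
    have := w.2
    simp only [δ, Finset.coe_range, Set.mem_Iio]
    split_ifs <;> omega
  · intro w hw x hx hwx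
    have h := hs w hw
    have h' := hs x hx
    simp only [circ] at h h'
    have := v.2
    have := w.2
    have := x.2
    simp only [δ] at hwx
    apply Fin.ext
    split_ifs at hwx <;> omega

theorem circ_edges (n r e : ℕ) (he : e ≤ 1) (hn : 2 * r + 2 + e ≤ n) :
    n * r + e * (n / 2) ≤ (circ n r e).edgeSet.ncard := by
  classical
  let f : (Fin n × Fin r) ⊕ (Fin e × Fin (n / 2)) → Sym2 (Fin n) := fun p =>
    match p with
    | .inl (i, s) => s(i, if h : i.val + s.val + 1 < n then ⟨i.val + s.val + 1, h⟩ else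
        ⟨i.val + s.val + 1 - n, by omega⟩)
    | .inr (_, i) => s(⟨i.val, by omega⟩, ⟨i.val + n / 2, by omega⟩)
  have hf : Function.Injective f := by
    rintro (⟨i, s⟩ | ⟨t, i⟩) (⟨j, s'⟩ | ⟨t', j⟩) h
    · simp only [f, Sym2.eq_iff] at h
      have : i.val = j.val ∧ s.val = s'.val := by
        split_ifs at h <;> simp only [Fin.ext_iff] at h <;> omega
      rw [Fin.ext this.1, Fin.ext this.2]
    · exfalso
      simp only [f, Sym2.eq_iff] at h
      split_ifs at h <;> simp only [Fin.ext_iff] at h <;> omega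
    · exfalso
      simp only [f, Sym2.eq_iff] at h
      split_ifs at h <;> simp only [Fin.ext_iff] at h <;> omega
    · simp only [f, Sym2.eq_iff, Fin.ext_iff] at h
      have h1 : i = j := Fin.ext (by omega)
      have h2 : t = t' := Fin.ext (by omega)
      rw [h1, h2]
  have hsub : Set.range f ⊆ (circ n r e).edgeSet := by
    rintro _ ⟨(⟨i, s⟩ | ⟨t, i⟩), rfl⟩
    · simp only [f, mem_edgeSet, circ]
      split_ifs <;> simp only <;> omega
    · simp only [f, mem_edgeSet, circ]
      have ht := t.2
      have he1 : e = 1 := by omega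
      have hi := i.2
      refine ⟨by omega, Or.inr (Or.inr (Or.inr (Or.inl ⟨he1, hi, ?_⟩)))⟩
      trivial
  calc n * r + e * (n / 2) = (Set.range f).ncard := by
        rw [← Set.image_univ, Set.ncard_image_of_injective _ hf, Set.ncard_univ,
          Nat.card_eq_fintype_card]
        simp
    _ ≤ _ := Set.ncard_le_ncard hsub (Set.toFinite _)

/-- Proposition (maximum degree construction): for a tree `T` on `k ≥ 4` vertices and
`n ≥ k`, `ex_c(n,T) ≥ ⌊n(Δ(T)-1)/2⌋`. -/
theorem exConn_ge_of_maxDegree {V : Type*} [Fintype V] (T : SimpleGraph V)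
    [DecidableRel T.Adj] (k : ℕ) (hk : 4 ≤ k) (hcard : Fintype.card V = k) (hT : T.IsTree)
    (n : ℕ) (hn : k ≤ n) :
    n * (T.maxDegree - 1) / 2 ≤ exConn n T := by
  classical
  have hnt : Nontrivial V := Fintype.one_lt_card_iff_nontrivial.mp (by omega)
  rcases le_or_gt T.maxDegree 2 with hD | hD
  · have h0 : 0 < n := by omega
    let z : Fin n := ⟨0, h0⟩
    have hc : (myStar z).Connected := by
      have : Nonempty (Fin n) := ⟨z⟩
      have key : ∀ a, (myStar z).Reachable z a := by
        intro a
        by_cases h : z = a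
        · rw [h]
        · exact Adj.reachable ⟨h, Or.inl rfl⟩
      exact ⟨fun a b => (key a).symm.trans (key b)⟩
    have hfree : ¬ ContainsCopy T (myStar z) := by
      rintro ⟨f, hf⟩
      have hex : ∀ x, ∃ y, T.Adj x y := fun x => by
        have := hT.1.preconnected.degree_pos_of_nontrivial x
        exact (T.degree_pos_iff_exists_adj x).mp this
      obtain ⟨c, hcz⟩ : ∃ c, f c = z := by
        obtain ⟨v⟩ : Nonempty V := inferInstance
        obtain ⟨w, hw⟩ := hex v
        rcases (hf hw).2 with h | h
        exacts [⟨_, h⟩, ⟨_, h⟩]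
      have hsub : Finset.univ.erase c ⊆ T.neighborFinset c := by
        intro x hx
        have hxc := Finset.ne_of_mem_erase hx
        obtain ⟨y, hy⟩ := hex x
        rw [mem_neighborFinset]
        rcases (hf hy).2 with h | h
        · exact absurd (f.injective (h.trans hcz.symm)) hxc
        · rw [← f.injective (h.trans hcz.symm)]
          exact hy.symm
      have h1 := Finset.card_le_card hsub
      rw [Finset.card_erase_of_mem (Finset.mem_univ _), card_neighborFinset_eq_degree,
        Finset.card_univ] at h1
      have h2 := T.degree_le_maxDegree c
      omega
    have h1 := le_exConn_of_graph T _ hc hfree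
    have h2 := hc.card_vert_le_card_edgeSet_add_one
    rw [Nat.card_fin, Nat.card_coe_set_eq] at h2
    have h3 : n * (T.maxDegree - 1) ≤ n * 1 := Nat.mul_le_mul_left _ (by omega)
    omega
  · have hlt : T.maxDegree < Fintype.card V := T.maxDegree_lt_card_verts
    obtain ⟨d, hd⟩ : ∃ d, T.maxDegree = d + 1 := ⟨T.maxDegree - 1, by omega⟩
    have hn' : 2 * (d / 2) + 2 + d % 2 ≤ n := by omega
    have he : d % 2 ≤ 1 := by omega
    have hc := circ_connected n (d / 2) (d % 2) (by omega) (by omega)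
    have hfree : ¬ ContainsCopy T (circ n (d / 2) (d % 2)) := by
      rintro ⟨f, hf⟩
      obtain ⟨v, hv⟩ := T.exists_maximal_degree_vertex
      have := circ_degree n (d / 2) (d % 2) he hn' (f v) ((T.neighborFinset v).map f) (by
        intro w hw
        obtain ⟨x, hx, rfl⟩ := Finset.mem_map.mp hw
        exact hf ((T.mem_neighborFinset v x).mp hx))
      rw [Finset.card_map, card_neighborFinset_eq_degree] at this
      omega
    have h1 := le_exConn_of_graph T _ hc hfree
    have h2 := circ_edges n (d / 2) (d % 2) he hn'
    refine le_trans ?_ (h2.trans h1)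
    rw [hd, Nat.add_sub_cancel]
    generalize hr : d / 2 = r
    have hdr : d = 2 * r + d % 2 := by omega
    rcases Nat.mod_two_eq_zero_or_one d with h | h <;> rw [h] at hdr ⊢ <;> subst hdr
    · have : n * (2 * r + 0) = 2 * (n * r) := by ring
      omega
    · have : n * (2 * r + 1) = 2 * (n * r) + n := by ring
      omega
end

section
/- For every tree T on k vertices there exists n_0 such that for all n ≥ n_0, ex_c(n,T) ≥ ⌊k/6⌋ · n. -/
open SimpleGraph

lemma le_exConn {α : Type*} {n : ℕ} (F : SimpleGraph α) (G : SimpleGraph (Fin n))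
    (hG : G.Connected) (hF : ¬ ContainsCopy F G) : G.edgeSet.ncard ≤ exConn n F := by
  refine le_csSup ⟨(Set.univ : Set (Sym2 (Fin n))).ncard, ?_⟩ ⟨G, hG, hF, rfl⟩
  rintro _ ⟨G', -, -, rfl⟩
  exact Set.ncard_le_ncard (Set.subset_univ _) Set.finite_univ

lemma edge_count (H : SimpleGraph ℕ) (n : ℕ) (c : ℕ → ℕ)
    (hc : ∀ v < n, ∃ S : Finset ℕ, c v ≤ S.card ∧ ∀ u ∈ S, u < v ∧ H.Adj u v) :
    ∑ v ∈ Finset.range n, c v ≤ (H.comap (Fin.val : Fin n → ℕ)).edgeSet.ncard := by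
  classical
  have hc' : ∀ v, ∃ S : Finset ℕ, (v < n → c v ≤ S.card) ∧ ∀ u ∈ S, u < v ∧ H.Adj u v := by
    intro v
    by_cases h : v < n
    · obtain ⟨S, h1, h2⟩ := hc v h
      exact ⟨S, fun _ => h1, h2⟩
    · exact ⟨∅, fun h' => absurd h' h, by simp⟩
  choose S hS1 hS2 using hc'
  set E := (H.comap (Fin.val : Fin n → ℕ)).edgeSet with hE
  have hEf : E.Finite := Set.toFinite _
  let X := (Finset.range n).sigma S
  let g : (Σ _ : ℕ, ℕ) → Sym2 ℕ := fun x => s(x.2, x.1)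
  have hinj : Set.InjOn g X := by
    rintro ⟨v, u⟩ h ⟨v', u'⟩ h' heq
    simp only [X, Finset.coe_sigma, Set.mem_sigma_iff, Finset.mem_coe] at h h'
    have h1 := (hS2 v u h.2).1
    have h2 := (hS2 v' u' h'.2).1
    simp only [g, Sym2.eq_iff] at heq
    rcases heq with ⟨rfl, rfl⟩ | ⟨rfl, rfl⟩
    · rfl
    · omega
  have hsub : ((X.image g : Finset (Sym2 ℕ)) : Set (Sym2 ℕ)) ⊆ Sym2.map Fin.val '' E := by
    intro e he
    simp only [Finset.coe_image, Set.mem_image, Finset.mem_coe] at he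
    obtain ⟨⟨v, u⟩, hx, rfl⟩ := he
    simp only [X, Finset.mem_sigma, Finset.mem_range] at hx
    have h1 := hS2 v u hx.2
    refine ⟨s(⟨u, by omega⟩, ⟨v, hx.1⟩), ?_, by simp [g]⟩
    simp [hE, h1.2]
  calc ∑ v ∈ Finset.range n, c v ≤ ∑ v ∈ Finset.range n, (S v).card :=
        Finset.sum_le_sum fun v hv => hS1 v (Finset.mem_range.1 hv)
    _ = X.card := (Finset.card_sigma _ _).symm
    _ = (X.image g).card := (Finset.card_image_of_injOn hinj).symm
    _ = ((X.image g : Finset (Sym2 ℕ)) : Set (Sym2 ℕ)).ncard := (Set.ncard_coe_finset _).symm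
    _ ≤ (Sym2.map Fin.val '' E).ncard := Set.ncard_le_ncard hsub (hEf.image _)
    _ ≤ E.ncard := Set.ncard_image_le hEf

lemma conn_of_smaller (H : SimpleGraph ℕ) (n : ℕ) (hn : 0 < n)
    (h : ∀ v < n, 0 < v → ∃ u < v, H.Adj u v) :
    (H.comap (Fin.val : Fin n → ℕ)).Connected := by
  have key : ∀ v (hv : v < n), (H.comap (Fin.val : Fin n → ℕ)).Reachable ⟨0, hn⟩ ⟨v, hv⟩ := by
    intro v
    induction v using Nat.strong_induction_on with
    | _ v ih =>
      intro hv
      rcases Nat.eq_zero_or_pos v with rfl | h0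
      · exact Reachable.refl _
      · obtain ⟨u, hu, hadj⟩ := h v hv h0
        refine (ih u hu (by omega)).trans (Adj.reachable ?_)
        simpa using hadj
  rw [connected_iff]
  exact ⟨fun a b => (key a.1 a.2).symm.trans (key b.1 b.2), ⟨⟨0, hn⟩⟩⟩

/-- bipartite construction -/
lemma case_bip {V : Type*} [Fintype V] (T : SimpleGraph V) (m : ℕ)
    (hA : ¬ ∃ A : Finset V, A.card ≤ m + 1 ∧ ∀ a b, T.Adj a b → a ∈ A ∨ b ∈ A)
    (n : ℕ) (hn : (m + 2) * (m + 2) ≤ n) : m * n ≤ exConn n T := by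
  classical
  let P : ℕ → Prop := fun v => v ≠ 1 ∧ v ≤ m + 1
  let H : SimpleGraph ℕ :=
    { Adj := fun u v => (P u ∧ ¬ P v) ∨ (P v ∧ ¬ P u)
      symm := ⟨fun u v h => h.symm⟩
      loopless := ⟨fun u h => by tauto⟩ }
  have hn2 : m + 2 ≤ n := by nlinarith
  refine le_trans ?_ (le_exConn T (H.comap (Fin.val : Fin n → ℕ))
    (conn_of_smaller H n (by omega) ?_) ?_)
  · refine le_trans ?_ (edge_count H n (fun v => if v < m + 2 then 0 else m + 1) ?_)
    · obtain ⟨b, rfl⟩ := Nat.exists_eq_add_of_le hn2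
      rw [Finset.sum_range_add]
      have : ∑ x ∈ Finset.range b, (if m + 2 + x < m + 2 then 0 else m + 1) = b * (m + 1) := by
        simp
      rw [this]
      nlinarith [Nat.zero_le (∑ x ∈ Finset.range (m + 2), if x < m + 2 then 0 else m + 1)]
    · intro v _
      by_cases h : v < m + 2
      · exact ⟨∅, by simp [h], by simp⟩
      · refine ⟨(Finset.range (m + 2)).erase 1, ?_, ?_⟩
        · rw [Finset.card_erase_of_mem (by simp)]
          simp [h]
        · intro u hu
          simp only [Finset.mem_erase, Finset.mem_range] at hu
          refine ⟨by omega, Or.inl ⟨⟨hu.1, by omega⟩, fun h' => ?_⟩⟩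
          have := h'.2
          omega
  · intro v _ h0
    by_cases h : P v
    · refine ⟨1, ?_, Or.inr ⟨h, fun h' => h'.1 rfl⟩⟩
      have := h.1
      omega
    · exact ⟨0, h0, Or.inl ⟨⟨by omega, by omega⟩, h⟩⟩
  · rintro ⟨f, hf⟩
    apply hA
    refine ⟨Finset.univ.filter fun a => P (f a), ?_, ?_⟩
    · have : ((Finset.range (m + 2)).erase 1).card = m + 1 := by
        rw [Finset.card_erase_of_mem (by simp)]
        simp
      refine le_trans ?_ this.le
      refine Finset.card_le_card_of_injOn (fun a => (f a).val) ?_ ?_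
      · intro a ha
        simp only [Finset.coe_filter, Finset.mem_univ, true_and, Set.mem_ofPred_eq] at ha
        have h1 := ha.1
        have h2 := ha.2
        simp only [Finset.coe_erase, Finset.coe_range, Set.mem_sdiff, Set.mem_Iio,
          Set.mem_singleton_iff]
        exact ⟨by omega, h1⟩
      · intro a _ b _ h
        exact f.injective (Fin.ext h)
    · intro a b hab
      have := hf hab
      simp only [Finset.mem_filter, Finset.mem_univ, true_and]
      change (P (f a) ∧ ¬ P (f b)) ∨ (P (f b) ∧ ¬ P (f a)) at this
      tauto

/-- circulant construction -/
lemma case_deg {V : Type*} [Fintype V] (T : SimpleGraph V) (m : ℕ) (hm : 0 < m)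
    (x : V) (N : Finset V) (hN : ∀ y ∈ N, T.Adj x y) (hNc : 2 * m < N.card)
    (n : ℕ) (hn : 2 * m + 1 ≤ n) : m * n ≤ exConn n T := by
  classical
  let R : ℕ → ℕ → Prop := fun u v => u < v ∧ (v ≤ u + m ∨ u + n ≤ v + m)
  let H : SimpleGraph ℕ :=
    { Adj := fun u v => R u v ∨ R v u
      symm := ⟨fun u v h => h.symm⟩
      loopless := ⟨fun u h => by
        rcases h with h | h <;> exact absurd h.1 (lt_irrefl _)⟩ }
  refine le_trans ?_ (le_exConn T (H.comap (Fin.val : Fin n → ℕ))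
    (conn_of_smaller H n (by omega) ?_) ?_)
  · refine le_trans ?_ (edge_count H n (fun v => min v m + (v + m + 1 - n)) ?_)
    · rw [Finset.sum_add_distrib]
      obtain ⟨b, rfl⟩ : ∃ b, n = m + b := ⟨n - m, by omega⟩
      have h1 : ∑ v ∈ Finset.range (m + b), min v m
          = ∑ i ∈ Finset.range m, i + b * m := by
        rw [Finset.sum_range_add]
        congr 1
        · refine Finset.sum_congr rfl fun i hi => ?_
          have := Finset.mem_range.1 hi
          omega
        · rw [Finset.sum_congr rfl (g := fun _ => m) (fun i _ => by omega)]
          simp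
      have h2 : ∑ v ∈ Finset.range (m + b), (v + m + 1 - (m + b))
          = ∑ i ∈ Finset.range m, (i + 1) := by
        rw [add_comm m b, Finset.sum_range_add]
        rw [Finset.sum_congr rfl (g := fun _ => 0) (fun i hi => by
          have := Finset.mem_range.1 hi
          omega)]
        simp only [Finset.sum_const_zero, zero_add]
        exact Finset.sum_congr rfl fun i _ => by omega
      rw [h1, h2, Finset.sum_add_distrib]
      have h3 := Finset.sum_range_id_mul_two m
      obtain ⟨k, rfl⟩ : ∃ k, m = k + 1 := ⟨m - 1, by omega⟩
      simp only [Finset.sum_const, Finset.card_range, smul_eq_mul, Nat.add_sub_cancel] at *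
      nlinarith
    · intro v hv
      refine ⟨Finset.Ico (v - m) v ∪ Finset.range (v + m + 1 - n), ?_, ?_⟩
      · rw [Finset.card_union_of_disjoint]
        · simp only [Nat.card_Ico, Finset.card_range]
          omega
        · rw [Finset.disjoint_left]
          intro a ha hb
          simp only [Finset.mem_Ico, Finset.mem_range] at ha hb
          omega
      · intro u hu
        simp only [Finset.mem_union, Finset.mem_Ico, Finset.mem_range] at hu
        have : u < v := by omega
        exact ⟨this, Or.inl ⟨this, by omega⟩⟩
  · intro v _ h0
    exact ⟨v - 1, by omega, Or.inl ⟨by omega, Or.inl (by omega)⟩⟩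
  · rintro ⟨f, hf⟩
    let g1 : ℕ → ℕ := fun j => if (f x).val + j < n then (f x).val + j else (f x).val + j - n
    let g2 : ℕ → ℕ := fun j => if j ≤ (f x).val then (f x).val - j else (f x).val + n - j
    have hle : N.card ≤ ((Finset.Icc 1 m).image g1 ∪ (Finset.Icc 1 m).image g2).card := by
      refine Finset.card_le_card_of_injOn (fun a => (f a).val) ?_ ?_
      · intro y hy
        have hadj := hf (hN y hy)
        have hx := (f x).2
        have hy' := (f y).2
        change R (f x) (f y) ∨ R (f y) (f x) at hadj
        simp only [Finset.coe_union, Finset.coe_image, Set.mem_union, Set.mem_image,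
          Finset.coe_Icc, Set.mem_Icc]
        rcases hadj with ⟨h1, h2 | h2⟩ | ⟨h1, h2 | h2⟩
        · refine Or.inl ⟨(f y).val - (f x).val, by omega, ?_⟩
          simp only [g1]
          split_ifs <;> omega
        · refine Or.inr ⟨(f x).val + n - (f y).val, by omega, ?_⟩
          simp only [g2]
          split_ifs <;> omega
        · refine Or.inr ⟨(f x).val - (f y).val, by omega, ?_⟩
          simp only [g2]
          split_ifs <;> omega
        · refine Or.inl ⟨(f y).val + n - (f x).val, by omega, ?_⟩
          simp only [g1]
          split_ifs <;> omega
      · intro a _ b _ h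
        exact f.injective (Fin.ext h)
    have h1 := Finset.card_union_le ((Finset.Icc 1 m).image g1) ((Finset.Icc 1 m).image g2)
    have h2 := Finset.card_image_le (s := Finset.Icc 1 m) (f := g1)
    have h3 := Finset.card_image_le (s := Finset.Icc 1 m) (f := g2)
    simp only [Nat.card_Icc] at h2 h3
    omega

/-- `legRel m u v`: `u < v` are adjacent in the cliques-on-long-legs graph. -/
def legRel (m u v : ℕ) : Prop :=
  u < v ∧ ((u = 0 ∧ (v - 1) % (8 * m - 2) = 0) ∨ (u + 1 = v ∧ 1 ≤ (v - 1) % (8 * m - 2)) ∨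
    (1 ≤ u ∧ (u - 1) / (8 * m - 2) = (v - 1) / (8 * m - 2) ∧
      4 * m - 1 ≤ (u - 1) % (8 * m - 2) ∧ 4 * m - 1 ≤ (v - 1) % (8 * m - 2)))

def legGraph (m : ℕ) : SimpleGraph ℕ where
  Adj u v := legRel m u v ∨ legRel m v u
  symm := ⟨fun _ _ h => h.symm⟩
  loopless := ⟨fun u h => by rcases h with h | h <;> exact absurd h.1 (lt_irrefl _)⟩

def legDepth (m v : ℕ) : ℕ := if v = 0 then 0 else min ((v - 1) % (8 * m - 2) + 1) (4 * m)

lemma mod_step (p v : ℕ) (hv : 1 ≤ v) (h : 1 ≤ v % p) :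
    (v - 1) % p + 1 = v % p ∧ (v - 1) / p = v / p := by
  rcases Nat.eq_zero_or_pos p with rfl | hp
  · simp at *
    omega
  have h1 := Nat.div_add_mod v p
  have h2 := Nat.mod_lt v hp
  have h3 : v - 1 = (v % p - 1) + p * (v / p) := by omega
  rw [h3, Nat.add_mul_mod_self_left, Nat.add_mul_div_left _ _ hp,
    Nat.mod_eq_of_lt (by omega), Nat.div_eq_of_lt (by omega)]
  omega

lemma legRel_depth (m u v : ℕ) (hm : 0 < m) (h : legRel m u v) :
    legDepth m u ≤ legDepth m v + 1 ∧ legDepth m v ≤ legDepth m u + 1 := by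
  obtain ⟨h0, ⟨rfl, h1⟩ | ⟨rfl, h1⟩ | ⟨h1, h2, h3, h4⟩⟩ := h
  · simp only [legDepth]
    rw [if_pos trivial, if_neg (by omega), h1]
    omega
  · simp only [Nat.add_sub_cancel] at h1
    rcases Nat.eq_zero_or_pos u with rfl | hu
    · simp at h1
    have := (mod_step _ u hu h1).1
    simp only [legDepth, Nat.add_sub_cancel]
    rw [if_neg (by omega), if_neg (by omega)]
    omega
  · simp only [legDepth]
    rw [if_neg (by omega), if_neg (by omega)]
    omega

lemma legRel_leg (m u v : ℕ) (hu : u ≠ 0) (h : legRel m u v) :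
    (u - 1) / (8 * m - 2) = (v - 1) / (8 * m - 2) := by
  obtain ⟨h0, ⟨rfl, h1⟩ | ⟨rfl, h1⟩ | ⟨h1, h2, h3, h4⟩⟩ := h
  · exact absurd rfl hu
  · exact (mod_step _ u (by omega) h1).2
  · exact h2

lemma leg_nbr (m u v : ℕ) (hm : 0 < m) (h1 : 1 ≤ legDepth m v) (h2 : legDepth m v < 4 * m)
    (h : (legGraph m).Adj v u) :
    u = v + 1 ∨ u = (if (v - 1) % (8 * m - 2) = 0 then 0 else v - 1) := by
  have hv : v ≠ 0 := by
    rintro rfl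
    simp [legDepth] at h1
  simp only [legDepth, if_neg hv] at h1 h2
  rcases h with ⟨h0, ⟨rfl, h1⟩ | ⟨rfl, h1⟩ | ⟨h1, h2, h3, h4⟩⟩ |
    ⟨h0, ⟨rfl, h1⟩ | ⟨rfl, h1⟩ | ⟨h1, h2, h3, h4⟩⟩
  · exact absurd rfl hv
  · exact Or.inl rfl
  · omega
  · right; rw [if_pos h1]
  · right; rw [if_neg (by omega)]; omega
  · omega

def legCount (m s : ℕ) : ℕ := if s ≤ 4 * m - 1 then 1 else s - (4 * m - 1)

lemma legCount_sum (m : ℕ) (hm : 0 < m) :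
    ∑ s ∈ Finset.range (8 * m - 2), legCount m s = m * (8 * m - 2) + 1 := by
  obtain ⟨k, rfl⟩ : ∃ k, m = k + 1 := ⟨m - 1, by omega⟩
  have : 8 * (k + 1) - 2 = (4 * k + 4) + (4 * k + 2) := by omega
  rw [this, Finset.sum_range_add]
  rw [Finset.sum_congr rfl (g := fun _ => 1) (fun i hi => by
    have := Finset.mem_range.1 hi
    simp only [legCount]
    rw [if_pos (by omega)])]
  rw [Finset.sum_congr (s₁ := Finset.range (4 * k + 2)) rfl (g := fun i => i + 1) (fun i hi => by
    simp only [legCount]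
    rw [if_neg (by omega)]
    omega)]
  rw [Finset.sum_add_distrib]
  have h3 := Finset.sum_range_id_mul_two (4 * k + 2)
  simp only [Finset.sum_const, Finset.card_range, smul_eq_mul] at *
  have h4 : 4 * k + 2 - 1 = 4 * k + 1 := by omega
  rw [h4] at h3
  nlinarith

lemma leg_total (m N : ℕ) (hm : 0 < m) :
    N * (m * (8 * m - 2) + 1) ≤ ∑ v ∈ Finset.range (1 + (8 * m - 2) * N),
      (if v = 0 then 0 else legCount m ((v - 1) % (8 * m - 2))) := by
  induction N with
  | zero => simp
  | succ N ih =>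
    have : 1 + (8 * m - 2) * (N + 1) = (1 + (8 * m - 2) * N) + (8 * m - 2) := by ring
    rw [this, Finset.sum_range_add]
    have h2 : ∑ x ∈ Finset.range (8 * m - 2), (if 1 + (8 * m - 2) * N + x = 0 then 0
        else legCount m ((1 + (8 * m - 2) * N + x - 1) % (8 * m - 2)))
        = ∑ s ∈ Finset.range (8 * m - 2), legCount m s := by
      refine Finset.sum_congr rfl fun x hx => ?_
      have hx' := Finset.mem_range.1 hx
      rw [if_neg (by omega)]
      congr 1
      have : 1 + (8 * m - 2) * N + x - 1 = x + (8 * m - 2) * N := by omega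
      rw [this, Nat.add_mul_mod_self_left, Nat.mod_eq_of_lt hx']
    rw [h2, legCount_sum m hm]
    linarith

lemma leg_smaller (m v : ℕ) (hm : 0 < m) :
    ∃ S : Finset ℕ, (if v = 0 then 0 else legCount m ((v - 1) % (8 * m - 2))) ≤ S.card ∧
      ∀ u ∈ S, u < v ∧ (legGraph m).Adj u v := by
  by_cases hv : v = 0
  · exact ⟨∅, by simp [hv], by simp⟩
  rw [if_neg hv]
  have hmod := Nat.div_add_mod (v - 1) (8 * m - 2)
  have hlt := Nat.mod_lt (v - 1) (show 8 * m - 2 > 0 by omega)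
  set q := (v - 1) / (8 * m - 2) with hq
  set s := (v - 1) % (8 * m - 2) with hs
  by_cases h : s ≤ 4 * m - 1
  · refine ⟨{if s = 0 then 0 else v - 1}, by simp [legCount, h], ?_⟩
    intro u hu
    rw [Finset.mem_singleton] at hu
    split_ifs at hu with h0
    · exact ⟨by omega, Or.inl ⟨by omega, Or.inl ⟨hu, by omega⟩⟩⟩
    · exact ⟨by omega, Or.inl ⟨by omega, Or.inr (Or.inl ⟨by omega, by omega⟩)⟩⟩
  · refine ⟨Finset.Ico (v - (s - (4 * m - 1))) v, ?_, ?_⟩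
    · simp only [legCount, if_neg h, Nat.card_Ico]
      omega
    · intro u hu
      rw [Finset.mem_Ico] at hu
      obtain ⟨i, hi⟩ : ∃ i, u + i = v := ⟨v - u, by omega⟩
      have h1 : u - 1 = (s - i) + (8 * m - 2) * q := by omega
      refine ⟨hu.2, Or.inl ⟨hu.2, Or.inr (Or.inr ⟨by omega, ?_, ?_, by omega⟩)⟩⟩
      · rw [h1, Nat.add_mul_div_left _ _ (by omega), Nat.div_eq_of_lt (by omega), zero_add]
      · rw [h1, Nat.add_mul_mod_self_left, Nat.mod_eq_of_lt (by omega)]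
        omega

lemma crossing {V : Type*} (T : SimpleGraph V) (hT : T.Connected) (S : Set V) (x y : V)
    (hx : x ∈ S) (hy : y ∉ S) : ∃ a b, T.Adj a b ∧ a ∈ S ∧ b ∉ S := by
  obtain ⟨p⟩ := hT.preconnected x y
  obtain ⟨d, -, h1, h2⟩ := p.exists_boundary_dart S hx hy
  exact ⟨d.fst, d.snd, d.adj, h1, h2⟩

lemma leg_free {V : Type*} [Fintype V] (T : SimpleGraph V) (m : ℕ) (hm : 0 < m)
    (hT : T.IsTree) (hk : 6 * m ≤ Fintype.card V)
    (A : Finset V) (hA : A.card ≤ m + 1) (hcov : ∀ a b, T.Adj a b → a ∈ A ∨ b ∈ A)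
    (hdeg : ∀ (x : V) (N : Finset V), (∀ y ∈ N, T.Adj x y) → N.card ≤ 2 * m)
    (f : V → ℕ) (hinj : Function.Injective f)
    (hf : ∀ a b, T.Adj a b → (legGraph m).Adj (f a) (f b)) : False := by
  classical
  let D : V → ℕ := fun v => legDepth m (f v)
  have hD : ∀ a b, T.Adj a b → D a ≤ D b + 1 ∧ D b ≤ D a + 1 := by
    intro a b h
    rcases hf a b h with h | h
    · exact legRel_depth m _ _ hm h
    · exact (legRel_depth m _ _ hm h).symm
  let Pth : V → Prop := fun v => 1 ≤ D v ∧ D v < 4 * m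
  -- degrees of path vertices
  have hpd : ∀ a, Pth a → T.degree a ≤ 2 := by
    intro a ha
    rw [← card_neighborFinset_eq_degree]
    calc (T.neighborFinset a).card ≤ ({f a + 1,
          (if (f a - 1) % (8 * m - 2) = 0 then 0 else f a - 1)} : Finset ℕ).card := by
          refine Finset.card_le_card_of_injOn f ?_ hinj.injOn
          intro b hb
          have hb' : T.Adj a b := by simpa using hb
          have := leg_nbr m (f b) (f a) hm ha.1 ha.2 (hf a b hb')
          simpa using this
      _ ≤ 2 := Finset.card_le_two
  have hd2 : ∀ a, T.degree a ≤ 2 * m := by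
    intro a
    rw [← card_neighborFinset_eq_degree]
    exact hdeg a _ (by simp)
  have hedges : T.edgeFinset.card ≤ ∑ a ∈ A, T.degree a := by
    calc T.edgeFinset.card ≤ (A.biUnion fun a => T.incidenceFinset a).card := by
          refine Finset.card_le_card ?_
          intro e
          induction e with
          | _ a b =>
            intro he
            have hab : T.Adj a b := by simpa using he
            rw [Finset.mem_biUnion]
            rcases hcov a b hab with h | h
            · exact ⟨a, h, by simp [mem_incidenceFinset, incidenceSet, hab]⟩
            · exact ⟨b, h, by simp [mem_incidenceFinset, incidenceSet, hab]⟩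
      _ ≤ ∑ a ∈ A, (T.incidenceFinset a).card := Finset.card_biUnion_le
      _ = _ := by simp
  have hE := hT.card_edgeFinset
  have hsplit := Finset.sum_filter_add_sum_filter_not A Pth (fun a => T.degree a)
  have hcsplit := Finset.card_filter_add_card_filter_not (s := A) Pth
  have hs1 : ∑ a ∈ A with Pth a, T.degree a ≤ (A.filter Pth).card * 2 := by
    refine Finset.sum_le_card_nsmul _ _ _ ?_
    intro a ha
    exact hpd a (Finset.mem_filter.1 ha).2
  have hs2 : ∑ a ∈ A with ¬ Pth a, T.degree a ≤ (A.filter fun a => ¬ Pth a).card * (2 * m) :=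
    Finset.sum_le_card_nsmul _ _ _ fun a _ => hd2 a
  have hspec : 2 ≤ (A.filter fun a => ¬ Pth a).card := by
    by_contra hlt
    have : (A.filter fun a => ¬ Pth a).card = 0 ∨ (A.filter fun a => ¬ Pth a).card = 1 := by omega
    rcases this with h | h <;> rw [h] at hs2 hcsplit <;> omega
  -- a special vertex in a clique
  obtain ⟨x, hx, y, hy, hxy⟩ := Finset.one_lt_card.1 hspec
  have hDle : ∀ v, D v ≤ 4 * m := by
    intro v
    simp only [D, legDepth]
    split_ifs <;> omega
  have hD0 : ∀ v, D v = 0 → f v = 0 := by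
    intro v hv
    by_contra h
    simp only [D, legDepth, if_neg h] at hv
    omega
  obtain ⟨z, hz⟩ : ∃ z, D z = 4 * m := by
    by_contra hno
    push Not at hno
    have key : ∀ v, ¬ Pth v → f v = 0 := by
      intro v hv
      apply hD0
      have h1 := hno v
      have h2 := hDle v
      simp only [Pth] at hv
      omega
    exact hxy (hinj ((key x (Finset.mem_filter.1 hx).2).trans
      (key y (Finset.mem_filter.1 hy).2).symm))
  -- all depths are large
  have hdeep : ∀ v, 2 * m + 1 ≤ D v := by
    by_contra hno
    push Not at hno
    obtain ⟨w, hw⟩ := hno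
    have hex : ∀ r, ∃ a, r < m → a ∈ A ∧ (D a = 4 * m - 2 - 2 * r ∨ D a = 4 * m - 1 - 2 * r) := by
      intro r
      by_cases hr : r < m
      · obtain ⟨a, b, hab, ha, hb⟩ := crossing T hT.connected
          {v | D v ≤ 4 * m - 2 - 2 * r} w z
          (by simp only [Set.mem_ofPred_eq]; omega) (by simp only [Set.mem_ofPred_eq]; omega)
        simp only [Set.mem_ofPred_eq] at ha hb
        have := hD a b hab
        rcases hcov a b hab with h | h
        · exact ⟨a, fun _ => ⟨h, by omega⟩⟩
        · exact ⟨b, fun _ => ⟨h, by omega⟩⟩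
      · exact ⟨w, fun h => absurd h hr⟩
    choose g hg using hex
    have : (Finset.range m).card ≤ (A.filter Pth).card := by
      refine Finset.card_le_card_of_injOn g ?_ ?_
      · intro r hr
        have hr' : r < m := by simpa using hr
        have := hg r hr'
        simp only [Finset.coe_filter, Set.mem_ofPred_eq, Pth]
        exact ⟨this.1, by omega⟩
      · intro r hr r' hr' heq
        have h1 : r < m := by simpa using hr
        have h2 : r' < m := by simpa using hr'
        have h3 := (hg r h1).2
        have h4 := (hg r' h2).2
        rw [heq] at h3
        omega
    rw [Finset.card_range] at this
    omega
  have hf0 : ∀ v, f v ≠ 0 := by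
    intro v hv
    have := hdeep v
    simp [D, legDepth, hv] at this
  have hleg : ∀ v, (f v - 1) / (8 * m - 2) = (f z - 1) / (8 * m - 2) := by
    by_contra hno
    push Not at hno
    obtain ⟨w, hw⟩ := hno
    obtain ⟨a, b, hab, ha, hb⟩ := crossing T hT.connected
      {v | (f v - 1) / (8 * m - 2) = (f z - 1) / (8 * m - 2)} z w rfl hw
    simp only [Set.mem_ofPred_eq] at ha hb
    rcases hf a b hab with h | h
    · exact hb ((legRel_leg m _ _ (hf0 a) h).symm.trans ha)
    · exact hb ((legRel_leg m _ _ (hf0 b) h).trans ha)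
  have : (Finset.univ : Finset V).card ≤ (Finset.Ico (2 * m) (8 * m - 2)).card := by
    refine Finset.card_le_card_of_injOn (fun v => (f v - 1) % (8 * m - 2)) ?_ ?_
    · intro v _
      have h1 := hdeep v
      simp only [D, legDepth, if_neg (hf0 v)] at h1
      have hlt := Nat.mod_lt (f v - 1) (show 8 * m - 2 > 0 by omega)
      simp only [Finset.coe_Ico, Set.mem_Ico]
      omega
    · intro v _ v' _ heq
      apply hinj
      have h1 := Nat.div_add_mod (f v - 1) (8 * m - 2)
      have h2 := Nat.div_add_mod (f v' - 1) (8 * m - 2)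
      simp only at heq
      rw [hleg v, heq] at h1
      rw [hleg v'] at h2
      have h3 := hf0 v
      have h4 := hf0 v'
      omega
  rw [Finset.card_univ, Nat.card_Ico] at this
  omega

lemma case_leg {V : Type*} [Fintype V] (T : SimpleGraph V) (m : ℕ) (hm : 0 < m)
    (hT : T.IsTree) (hk : 6 * m ≤ Fintype.card V)
    (A : Finset V) (hA : A.card ≤ m + 1) (hcov : ∀ a b, T.Adj a b → a ∈ A ∨ b ∈ A)
    (hdeg : ∀ (x : V) (N : Finset V), (∀ y ∈ N, T.Adj x y) → N.card ≤ 2 * m)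
    (n : ℕ) (hn : 1 + (8 * m - 2) * (m * (8 * m - 2)) ≤ n) : m * n ≤ exConn n T := by
  refine le_trans ?_ (le_exConn T ((legGraph m).comap (Fin.val : Fin n → ℕ))
    (conn_of_smaller _ n (by omega) ?_) ?_)
  · refine le_trans ?_ (edge_count _ n _ fun v _ => leg_smaller m v hm)
    have hp : 0 < 8 * m - 2 := by omega
    have hmod := Nat.div_add_mod (n - 1) (8 * m - 2)
    have hlt := Nat.mod_lt (n - 1) hp
    have hN : m * (8 * m - 2) ≤ (n - 1) / (8 * m - 2) := by
      rw [Nat.le_div_iff_mul_le hp, mul_comm]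
      omega
    set N := (n - 1) / (8 * m - 2)
    set s := (n - 1) % (8 * m - 2)
    have hnn : n = 1 + (8 * m - 2) * N + s := by omega
    refine le_trans (le_trans ?_ (leg_total m N hm))
      (Finset.sum_le_sum_of_subset (Finset.range_mono (by omega)))
    rw [hnn]
    have : m * (s + 1) ≤ m * (8 * m - 2) := Nat.mul_le_mul_left _ hlt
    calc m * (1 + (8 * m - 2) * N + s) = N * (m * (8 * m - 2)) + m * (s + 1) := by ring
      _ ≤ N * (m * (8 * m - 2)) + N := by omega
      _ = _ := by ring
  · intro v _ h0
    obtain ⟨S, h1, h2⟩ := leg_smaller m v hm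
    have hpos : 0 < S.card := by
      refine lt_of_lt_of_le ?_ h1
      rw [if_neg (by omega)]
      simp only [legCount]
      split_ifs <;> omega
    obtain ⟨u, hu⟩ := Finset.card_pos.1 hpos
    exact ⟨u, h2 u hu⟩
  · rintro ⟨f, hf⟩
    exact leg_free T m hm hT hk A hA hcov hdeg (fun v => (f v).val)
      (Fin.val_injective.comp f.injective) (fun a b h => hf h)

/-- For every tree `T` on `k` vertices, `ex_c(n,T) ≥ ⌊k/6⌋ n` for all large enough `n`. -/
theorem exConn_ge_general {V : Type*} [Fintype V] (T : SimpleGraph V) (k : ℕ)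
    (hcard : Fintype.card V = k) (hT : T.IsTree) :
    ∃ n₀ : ℕ, ∀ n ≥ n₀, k / 6 * n ≤ exConn n T := by
  rcases Nat.eq_zero_or_pos (k / 6) with h0 | hm
  · exact ⟨0, fun n _ => by simp [h0]⟩
  have hk : 6 * (k / 6) ≤ Fintype.card V := by omega
  generalize k / 6 = m at hm hk
  by_cases hA : ∃ A : Finset V, A.card ≤ m + 1 ∧ ∀ a b, T.Adj a b → a ∈ A ∨ b ∈ A
  · by_cases hd : ∃ (x : V) (N : Finset V), (∀ y ∈ N, T.Adj x y) ∧ 2 * m < N.card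
    · obtain ⟨x, N, hN, hc⟩ := hd
      exact ⟨2 * m + 1, fun n hn => case_deg T m hm x N hN hc n hn⟩
    · push Not at hd
      obtain ⟨A, hA1, hA2⟩ := hA
      exact ⟨_, fun n hn => case_leg T m hm hT hk A hA1 hA2 hd n hn⟩
  · exact ⟨_, fun n hn => case_bip T m hA n hn⟩
end

section
/- Let D*_{2,2} be the tree on 7 vertices obtained from the double star D_{2,2} by attaching one additional leaf to one of the leaves of D_{2,2}. Then ex_c(n, D*_{2,2}) = 2n − 3 for all n ≥ 7, and ex_c(n, D*_{2,2}) = C(n,2) for all 1 ≤ n ≤ 6, where C(n,2) denotes the binomial coefficient n choose 2. -/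
open SimpleGraph

/-- The tree `D*_{2,2}` on 7 vertices, obtained from the double star `D_{2,2}`
(adjacent centers `0`, `1`; leaves `2, 3` of `0` and `4, 5` of `1`) by attaching the
additional leaf `6` to the leaf `2`. -/
def doubleStar22Star : SimpleGraph (Fin 7) :=
  SimpleGraph.fromRel (fun i j =>
    (i = 0 ∧ j = 1) ∨ (i = 0 ∧ j = 2) ∨ (i = 0 ∧ j = 3) ∨ (i = 1 ∧ j = 4) ∨
    (i = 1 ∧ j = 5) ∨ (i = 2 ∧ j = 6))

section helpers

variable {V : Type*}

/-- A copy of `D_{2,2}` with centers `u`, `v`, leaves `a, b` of `u` and `c, d` of `v`. -/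
def IsDD (G : SimpleGraph V) (u v a b c d : V) : Prop :=
  G.Adj u v ∧ G.Adj u a ∧ G.Adj u b ∧ G.Adj v c ∧ G.Adj v d ∧
  [u, v, a, b, c, d].Nodup

lemma IsDD.swap {G : SimpleGraph V} {u v a b c d : V} (h : IsDD G u v a b c d) :
    IsDD G v u c d a b := by
  obtain ⟨h1, h2, h3, h4, h5, h6⟩ := h
  refine ⟨h1.symm, h4, h5, h2, h3, ?_⟩
  simp only [List.nodup_cons, List.mem_cons, List.not_mem_nil] at h6 ⊢
  grind

lemma IsDD.swapL {G : SimpleGraph V} {u v a b c d : V} (h : IsDD G u v a b c d) :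
    IsDD G u v b a c d := by
  obtain ⟨h1, h2, h3, h4, h5, h6⟩ := h
  refine ⟨h1, h3, h2, h4, h5, ?_⟩
  simp only [List.nodup_cons, List.mem_cons, List.not_mem_nil] at h6 ⊢
  grind

lemma leaf_nbr {G : SimpleGraph V} (hF : ¬ ContainsCopy doubleStar22Star G)
    {u v a b c d x : V} (h : IsDD G u v a b c d) (hx : G.Adj a x) :
    x = u ∨ x = v ∨ x = b ∨ x = c ∨ x = d := by
  by_contra hcon
  push Not at hcon
  obtain ⟨x1, x2, x3, x4, x5⟩ := hcon
  obtain ⟨h1, h2, h3, h4, h5, h6⟩ := h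
  have hxa : x ≠ a := hx.ne'
  apply hF
  refine ⟨⟨![u, v, a, b, c, d, x], ?_⟩, ?_⟩
  · have : List.Nodup (List.ofFn ![u, v, a, b, c, d, x]) := by
      simp only [List.ofFn_succ, List.ofFn_zero, List.nodup_cons, List.mem_cons,
        List.not_mem_nil] at h6 ⊢
      simp
      grind
    exact List.nodup_ofFn.mp this
  · intro i j hij
    simp only [doubleStar22Star, SimpleGraph.fromRel_adj] at hij
    obtain ⟨-, hij⟩ := hij
    rcases hij with hij | hij <;>
      rcases hij with ⟨rfl, rfl⟩ | ⟨rfl, rfl⟩ | ⟨rfl, rfl⟩ | ⟨rfl, rfl⟩ | ⟨rfl, rfl⟩ | ⟨rfl, rfl⟩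
    exacts [h1, h2, h3, h4, h5, hx, h1.symm, h2.symm, h3.symm, h4.symm, h5.symm, hx.symm]

lemma closed_univ {G : SimpleGraph V} (hc : G.Connected) (P : V → Prop) (u : V) (hu : P u)
    (hP : ∀ x y, P x → G.Adj x y → P y) (y : V) : P y := by
  obtain ⟨w⟩ := hc.preconnected u y
  induction w with
  | nil => exact hu
  | cons h _ ih => exact ih (hP _ _ hu h)

variable [Fintype V] [DecidableEq V] (G : SimpleGraph V) [DecidableRel G.Adj]

lemma sum_bound_two {u v : V} (huv : u ≠ v) (hn : 2 ≤ Fintype.card V)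
    (h : ∀ x y, x ≠ u → x ≠ v → G.Adj x y → y = u ∨ y = v) :
    ∑ x, G.degree x + 6 ≤ 4 * Fintype.card V := by
  have hle : ∀ x : V, G.degree x ≤ 2 + (if x = u then Fintype.card V - 3 else 0)
      + (if x = v then Fintype.card V - 3 else 0) := by
    intro x
    have := G.degree_lt_card_verts x
    by_cases h1 : x = u
    · simp [h1] at this ⊢; omega
    by_cases h2 : x = v
    · simp [h2] at this ⊢; omega
    have h3 : G.neighborFinset x ⊆ {u, v} := by
      intro y hy
      simpa using h x y h1 h2 (by simpa using hy)
    have := Finset.card_le_card h3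
    rw [Finset.card_pair huv, SimpleGraph.card_neighborFinset_eq_degree] at this
    simp [h1, h2, this]
  by_cases h2 : Fintype.card V = 2
  · have : ∑ x, G.degree x ≤ ∑ x : V, 1 := Finset.sum_le_sum (fun x _ => by
      have := G.degree_lt_card_verts x; omega)
    simp at this; omega
  have := Finset.sum_le_sum (fun x (_ : x ∈ Finset.univ) => hle x)
  simp [Finset.sum_add_distrib] at this
  omega

lemma sum_bound_four {u v c d : V} (hn : 5 ≤ Fintype.card V)
    (huv : u ≠ v) (huc : u ≠ c) (hud : u ≠ d) (hvc : v ≠ c) (hvd : v ≠ d) (hcd : c ≠ d)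
    (h : ∀ x y, x ≠ u → x ≠ v → x ≠ c → x ≠ d → G.Adj x y → y = u)
    (hv : ∀ y, G.Adj v y → y = u ∨ y = c ∨ y = d)
    (hc : ∀ y, G.Adj c y → y = u ∨ y = v ∨ y = d)
    (hd : ∀ y, G.Adj d y → y = u ∨ y = v ∨ y = c) :
    ∑ x, G.degree x + 6 ≤ 4 * Fintype.card V := by
  have key : ∀ x p q r : V, (∀ y, G.Adj x y → y = p ∨ y = q ∨ y = r) → G.degree x ≤ 3 := by
    intro x p q r hx
    have h3 : G.neighborFinset x ⊆ {p, q, r} := by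
      intro y hy
      simpa using hx y (by simpa using hy)
    have := Finset.card_le_card h3
    rw [SimpleGraph.card_neighborFinset_eq_degree] at this
    exact this.trans Finset.card_le_three
  have hle : ∀ x : V, G.degree x ≤ 1 + (if x = u then Fintype.card V - 2 else 0)
      + (if x = v then 2 else 0) + (if x = c then 2 else 0) + (if x = d then 2 else 0) := by
    intro x
    have := G.degree_lt_card_verts x
    by_cases h1 : x = u
    · simp [h1] at this ⊢; omega
    by_cases h2 : x = v
    · have := key v _ _ _ hv
      subst h2; simp; omega
    by_cases h3 : x = c
    · have := key c _ _ _ hc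
      subst h3; simp; omega
    by_cases h4 : x = d
    · have := key d _ _ _ hd
      subst h4; simp; omega
    have h5 : G.neighborFinset x ⊆ {u} := by
      intro y hy
      simpa using h x y h1 h2 h3 h4 (by simpa using hy)
    have := Finset.card_le_card h5
    rw [SimpleGraph.card_neighborFinset_eq_degree] at this
    simpa [h1, h2, h3, h4] using this
  have := Finset.sum_le_sum (fun x (_ : x ∈ Finset.univ) => hle x)
  simp [Finset.sum_add_distrib] at this
  omega



set_option maxHeartbeats 2000000 in
lemma case_DD_aux (hF : ¬ ContainsCopy doubleStar22Star G) (hG : G.Connected)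
    (hn : 7 ≤ Fintype.card V) {u v a b c d w : V} (h : IsDD G u v a b c d)
    (hw : w ∉ [u, v, a, b, c, d]) (huw : G.Adj u w) :
    ∑ x, G.degree x + 6 ≤ 4 * Fintype.card V := by
  have La := fun x => leaf_nbr (x := x) hF h
  have Lb := fun x => leaf_nbr (x := x) hF h.swapL
  have Lc := fun x => leaf_nbr (x := x) hF h.swap
  have Ld := fun x => leaf_nbr (x := x) hF h.swap.swapL
  have h0 := h
  obtain ⟨h1, h2, h3, h4, h5, h6⟩ := h
  have Q : ∀ x, x ∉ [u, v, a, b, c, d] → (G.Adj u x ∨ G.Adj v x) → ∀ y, G.Adj x y →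
      y = u ∨ y = v := by
    intro x hx hux y hxy
    have hyx := hxy.symm
    have : y ∈ [u, v, a, b, c, d] := by
      rcases hux with hux | hux
      · have D : IsDD G u v x b c d := by
          refine ⟨h1, hux, h3, h4, h5, ?_⟩
          simp only [List.nodup_cons, List.mem_cons, List.not_mem_nil] at h6 hx ⊢
          grind
        have := leaf_nbr hF D hxy
        simp only [List.mem_cons]; grind
      · have D : IsDD G v u x d a b := by
          refine ⟨h1.symm, hux, h5, h2, h3, ?_⟩
          simp only [List.nodup_cons, List.mem_cons, List.not_mem_nil] at h6 hx ⊢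
          grind
        have := leaf_nbr hF D hxy
        simp only [List.mem_cons]; grind
    simp only [List.mem_cons, List.not_mem_nil, or_false, not_or] at this hx
    rcases this with rfl | rfl | rfl | rfl | rfl | rfl
    · exact Or.inl rfl
    · exact Or.inr rfl
    · have := La x hyx; grind
    · have := Lb x hyx; grind
    · have := Lc x hyx; grind
    · have := Ld x hyx; grind
  have hall : ∀ x, x ∈ [u, v, a, b, c, d] ∨ (G.Adj u x ∨ G.Adj v x) := by
    refine closed_univ hG _ u (Or.inl (by simp)) ?_
    intro x y hx hxy
    by_cases hxs : x ∈ [u, v, a, b, c, d]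
    · simp only [List.mem_cons, List.not_mem_nil, or_false] at hxs ⊢
      rcases hxs with rfl | rfl | rfl | rfl | rfl | rfl
      · exact Or.inr (Or.inl hxy)
      · exact Or.inr (Or.inr hxy)
      · have := La y hxy; grind
      · have := Lb y hxy; grind
      · have := Lc y hxy; grind
      · have := Ld y hxy; grind
    · have := Q x hxs (by grind) y hxy
      left; simp only [List.mem_cons]; grind
  have D1 : IsDD G u v w b c d := by
    refine ⟨h1, huw, h3, h4, h5, ?_⟩
    simp only [List.nodup_cons, List.mem_cons, List.not_mem_nil] at h6 hw ⊢
    grind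
  have D2 : IsDD G u v a w c d := by
    refine ⟨h1, h2, huw, h4, h5, ?_⟩
    simp only [List.nodup_cons, List.mem_cons, List.not_mem_nil] at h6 hw ⊢
    grind
  have Lb' := fun x => leaf_nbr (x := x) hF D1.swapL
  have Lc' := fun x => leaf_nbr (x := x) hF D1.swap
  have Ld' := fun x => leaf_nbr (x := x) hF D1.swap.swapL
  have La' := fun x => leaf_nbr (x := x) hF D2
  have Lc'' := fun x => leaf_nbr (x := x) hF D2.swap
  have Ld'' := fun x => leaf_nbr (x := x) hF D2.swap.swapL
  simp only [List.nodup_cons, List.mem_cons, List.not_mem_nil, or_false, not_or] at h6 hw Q hall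
  have Mc : ∀ y, G.Adj c y → y = u ∨ y = v ∨ y = d := by
    intro y hy
    have := Lc y hy; have := Lc' y hy; have := Lc'' y hy
    grind
  have Md : ∀ y, G.Adj d y → y = u ∨ y = v ∨ y = c := by
    intro y hy
    have := Ld y hy; have := Ld' y hy; have := Ld'' y hy
    grind
  have Ma : ∀ y, G.Adj a y → y = u ∨ y = v := by
    intro y hy
    have := La y hy; have := La' y hy
    have h7 : y ≠ c := by rintro rfl; have := Mc _ hy.symm; grind
    have h8 : y ≠ d := by rintro rfl; have := Md _ hy.symm; grind
    grind
  have Mb : ∀ y, G.Adj b y → y = u ∨ y = v := by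
    intro y hy
    have := Lb y hy; have := Lb' y hy
    have h7 : y ≠ c := by rintro rfl; have := Mc _ hy.symm; grind
    have h8 : y ≠ d := by rintro rfl; have := Md _ hy.symm; grind
    grind
  have Mx : ∀ x y, x ≠ u → x ≠ v → x ≠ c → x ≠ d → G.Adj x y → y = u ∨ y = v := by
    intro x y x1 x2 x3 x4 hxy
    by_cases xa : x = a
    · subst xa; exact Ma y hxy
    by_cases xb : x = b
    · subst xb; exact Mb y hxy
    exact Q x (by grind) (by have := hall x; grind) y hxy
  by_cases hcd : G.Adj c d
  · refine sum_bound_four G (u := u) (v := v) (c := c) (d := d) (by omega)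
      (by grind) (by grind) (by grind) (by grind) (by grind) (by grind) ?_ ?_ Mc Md
    · intro x y x1 x2 x3 x4 hxy
      rcases Mx x y x1 x2 x3 x4 hxy with h7 | h7
      · exact h7
      subst h7
      exfalso
      have : ∀ p q, G.Adj u p → G.Adj u q → [u, y, p, q, c, x].Nodup → d ≠ p → d ≠ q → False := by
        intro p q hp hq hnd hdp hdq
        have D : IsDD G u y p q c x := ⟨h1, hp, hq, h4, hxy.symm, hnd⟩
        have := leaf_nbr hF D.swap hcd
        grind
      simp only [List.nodup_cons, List.mem_cons, List.not_mem_nil, or_false, not_or] at this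
      by_cases xa : x = a
      · exact this w b huw h3 (by grind) (by grind) (by grind)
      by_cases xb : x = b
      · exact this w a huw h2 (by grind) (by grind) (by grind)
      exact this a b h2 h3 (by grind) (by grind) (by grind)
    · intro y hy
      by_contra hcon
      push Not at hcon
      have hyv : y ≠ v := hy.ne'
      have : ∀ p q, G.Adj u p → G.Adj u q → [u, v, p, q, c, y].Nodup → d ≠ p → d ≠ q → False := by
        intro p q hp hq hnd hdp hdq
        have D : IsDD G u v p q c y := ⟨h1, hp, hq, h4, hy, hnd⟩
        have := leaf_nbr hF D.swap hcd
        grind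
      simp only [List.nodup_cons, List.mem_cons, List.not_mem_nil, or_false, not_or] at this
      by_cases xa : y = a
      · exact this w b huw h3 (by grind) (by grind) (by grind)
      by_cases xb : y = b
      · exact this w a huw h2 (by grind) (by grind) (by grind)
      exact this a b h2 h3 (by grind) (by grind) (by grind)
  · refine sum_bound_two G (u := u) (v := v) (by grind) (by omega) ?_
    intro x y x1 x2 hxy
    by_cases x3 : x = c
    · subst x3
      have := Mc y hxy
      have : y ≠ d := by rintro rfl; exact hcd hxy
      grind
    by_cases x4 : x = d
    · subst x4
      have := Md y hxy
      have : y ≠ c := by rintro rfl; exact hcd hxy.symm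
      grind
    exact Mx x y x1 x2 x3 x4 hxy

set_option maxHeartbeats 2000000 in
lemma case_DD (hF : ¬ ContainsCopy doubleStar22Star G) (hG : G.Connected)
    (hn : 7 ≤ Fintype.card V) {u v a b c d : V} (h : IsDD G u v a b c d) :
    ∑ x, G.degree x + 6 ≤ 4 * Fintype.card V := by
  by_cases h1 : ∃ w, w ∉ [u, v, a, b, c, d] ∧ G.Adj u w
  · obtain ⟨w, hw, hw'⟩ := h1
    exact case_DD_aux G hF hG hn h hw hw'
  by_cases h2 : ∃ w, w ∉ [u, v, a, b, c, d] ∧ G.Adj v w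
  · obtain ⟨w, hw, hw'⟩ := h2
    refine case_DD_aux G hF hG hn h.swap ?_ hw'
    simp only [List.mem_cons, List.not_mem_nil] at hw ⊢
    grind
  exfalso
  push Not at h1 h2
  have La := fun x => leaf_nbr (x := x) hF h
  have Lb := fun x => leaf_nbr (x := x) hF h.swapL
  have Lc := fun x => leaf_nbr (x := x) hF h.swap
  have Ld := fun x => leaf_nbr (x := x) hF h.swap.swapL
  have hall : ∀ x, x ∈ [u, v, a, b, c, d] := by
    refine closed_univ hG _ u (by simp) ?_
    intro x y hx hxy
    by_contra hy
    have h1 := h1 y hy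
    have h2 := h2 y hy
    simp only [List.mem_cons, List.not_mem_nil, or_false] at hx hy
    rcases hx with rfl | rfl | rfl | rfl | rfl | rfl
    · exact h1 hxy
    · exact h2 hxy
    · have := La y hxy; grind
    · have := Lb y hxy; grind
    · have := Lc y hxy; grind
    · have := Ld y hxy; grind
  have : (Finset.univ : Finset V) ⊆ [u, v, a, b, c, d].toFinset := by
    intro x _
    exact List.mem_toFinset.mpr (hall x)
  have := Finset.card_le_card this
  have := List.toFinset_card_le [u, v, a, b, c, d]
  simp only [Finset.card_univ, List.length_cons, List.length_nil] at *
  omega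

/-- Two distinct elements of a finset avoiding a small finset. -/
lemma two_avoid (s t : Finset V) (h : t.card + 2 ≤ s.card) :
    ∃ a b, a ∈ s ∧ b ∈ s ∧ a ∉ t ∧ b ∉ t ∧ a ≠ b := by
  have h1 : 1 < (s \ t).card := by
    have := Finset.le_card_sdiff t s
    omega
  obtain ⟨a, ha, b, hb, hab⟩ := Finset.one_lt_card.mp h1
  simp only [Finset.mem_sdiff] at ha hb
  exact ⟨a, b, ha.1, hb.1, ha.2, hb.2, hab⟩

lemma deg_five (hD : ∀ u v a b c d, ¬ IsDD G u v a b c d) {u v : V} (hu : 5 ≤ G.degree u)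
    (huv : G.Adj u v) : G.degree v ≤ 2 := by
  by_contra hv
  push Not at hv
  obtain ⟨c, d, hc, hd, hcu, hdu, hcd⟩ := two_avoid (G.neighborFinset v) {u} (by
    simp [SimpleGraph.card_neighborFinset_eq_degree]; omega)
  obtain ⟨a, b, ha, hb, ha', hb', hab⟩ := two_avoid (G.neighborFinset u) {v, c, d} (by
    have := Finset.card_le_three (a := v) (b := c) (c := d)
    simp only [SimpleGraph.card_neighborFinset_eq_degree]; omega)
  simp only [SimpleGraph.mem_neighborFinset, Finset.mem_insert, Finset.mem_singleton, not_or] at *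
  refine hD u v a b c d ⟨huv, ha, hb, hc, hd, ?_⟩
  have := huv.ne; have := ha.ne; have := hb.ne; have := hc.ne; have := hd.ne
  simp only [List.nodup_cons, List.mem_cons, List.not_mem_nil]
  grind

lemma deg_four (hD : ∀ u v a b c d, ¬ IsDD G u v a b c d) {u v x : V} (hu : 4 ≤ G.degree u)
    (huv : G.Adj u v) (hv : 3 ≤ G.degree v) (hx : G.Adj v x) : x = u ∨ G.Adj u x := by
  by_contra hcon
  push Not at hcon
  obtain ⟨d, _, hd, -, hdu, -, -⟩ : ∃ d d', d ∈ G.neighborFinset v ∧ True ∧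
      d ∉ ({u, x} : Finset V) ∧ True ∧ d' = d' := by
    have : 0 < (G.neighborFinset v \ {u, x}).card := by
      have := Finset.le_card_sdiff {u, x} (G.neighborFinset v)
      have := Finset.card_le_two (a := u) (b := x)
      simp only [SimpleGraph.card_neighborFinset_eq_degree] at *; omega
    obtain ⟨d, hd⟩ := Finset.card_pos.mp this
    simp only [Finset.mem_sdiff] at hd
    exact ⟨d, d, hd.1, trivial, hd.2, trivial, rfl⟩
  obtain ⟨a, b, ha, hb, ha', hb', hab⟩ := two_avoid (G.neighborFinset u) {v, d} (by
    have := Finset.card_le_two (a := v) (b := d)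
    simp only [SimpleGraph.card_neighborFinset_eq_degree]; omega)
  simp only [SimpleGraph.mem_neighborFinset, Finset.mem_insert, Finset.mem_singleton, not_or] at *
  refine hD u v a b x d ⟨huv, ha, hb, hx, hd, ?_⟩
  have := huv.ne; have := ha.ne; have := hb.ne; have := hx.ne; have := hd.ne
  have : a ≠ x := by rintro rfl; tauto
  have : b ≠ x := by rintro rfl; tauto
  simp only [List.nodup_cons, List.mem_cons, List.not_mem_nil]
  grind

lemma case_noDD (hD : ∀ u v a b c d, ¬ IsDD G u v a b c d) (hG : G.Connected)
    (hn : 7 ≤ Fintype.card V) :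
    ∑ x, G.degree x + 5 ≤ 4 * Fintype.card V := by
  set H : Finset V := Finset.univ.filter (fun x => 3 ≤ G.degree x) with hH
  set L : Finset V := Finset.univ.filter (fun x => ¬ 3 ≤ G.degree x) with hL
  have hcard : H.card + L.card = Fintype.card V := by
    rw [hH, hL, Finset.card_filter_add_card_filter_not, Finset.card_univ]
  have hsum : ∑ x ∈ H, G.degree x + ∑ x ∈ L, G.degree x = ∑ x, G.degree x := by
    rw [hH, hL, Finset.sum_filter_add_sum_filter_not]
  let dH : V → ℕ := fun x => (H.filter (fun y => G.Adj x y)).card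
  let dL : V → ℕ := fun x => (L.filter (fun y => G.Adj x y)).card
  have hdeg : ∀ x, G.degree x = dH x + dL x := by
    intro x
    have h1 : G.degree x = ((Finset.univ : Finset V).filter (fun y => G.Adj x y)).card := by
      rw [← SimpleGraph.card_neighborFinset_eq_degree]
      congr 1; ext y; simp
    rw [h1]
    simp only [dH, dL, hH, hL, Finset.filter_filter]
    rw [← Finset.card_filter_add_card_filter_not (s := Finset.univ.filter (fun y => G.Adj x y))
      (fun y => 3 ≤ G.degree y)]
    simp only [Finset.filter_filter]
    congr 2 <;> (ext y; simp [and_comm])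
  have hdouble : ∑ x ∈ H, dL x = ∑ x ∈ L, dH x := by
    simp only [dL, dH]
    have := Finset.sum_card_bipartiteAbove_eq_sum_card_bipartiteBelow (s := H) (t := L)
      (fun x y => G.Adj x y)
    simp only [Finset.bipartiteAbove, Finset.bipartiteBelow] at this
    rw [this]
    refine Finset.sum_congr rfl (fun x _ => ?_)
    congr 1; ext y; simp [G.adj_comm]
  have hLsum : ∑ x ∈ L, G.degree x ≤ 2 * L.card := by
    have : ∑ x ∈ L, G.degree x ≤ ∑ x ∈ L, 2 := Finset.sum_le_sum (fun x hx => by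
      simp [hL] at hx; omega)
    simpa [mul_comm] using this
  have hdHL : ∑ x ∈ L, dH x ≤ ∑ x ∈ L, G.degree x :=
    Finset.sum_le_sum (fun x _ => by rw [hdeg x]; omega)
  have hHsum : ∑ x ∈ H, G.degree x = ∑ x ∈ H, dH x + ∑ x ∈ H, dL x := by
    rw [← Finset.sum_add_distrib]; exact Finset.sum_congr rfl (fun x _ => hdeg x)
  have h5 : ∀ x, 5 ≤ G.degree x → dH x = 0 := by
    intro x hx
    simp only [dH, Finset.card_eq_zero, Finset.filter_eq_empty_iff]
    intro y hy hxy
    have := deg_five G hD hx hxy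
    simp [hH] at hy; omega
  have h3 : ∀ x, dH x ≤ 3 := by
    intro x
    by_contra hcon
    push Not at hcon
    have hle : G.degree x < 5 := by
      by_contra h; have := h5 x (by omega); omega
    have h4 : G.degree x = 4 := by have := hdeg x; omega
    have hL0 : dL x = 0 := by have := hdeg x; omega
    have hnb : ∀ y, G.Adj x y → 3 ≤ G.degree y := by
      intro y hy
      by_contra hy3
      simp only [dL, Finset.card_eq_zero, Finset.filter_eq_empty_iff] at hL0
      exact hL0 (x := y) (by simp [hL]; omega) hy
    have hall : ∀ y, y = x ∨ G.Adj x y := by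
      refine closed_univ hG _ x (Or.inl rfl) ?_
      intro y z hy hyz
      rcases hy with rfl | hy
      · exact Or.inr hyz
      · exact deg_four G hD h4.ge hy (hnb y hy) hyz
    have : (Finset.univ : Finset V) ⊆ insert x (G.neighborFinset x) := by
      intro y _
      simpa using hall y
    have h7 := Finset.card_le_card this
    have h8 := Finset.card_insert_le x (G.neighborFinset x)
    rw [SimpleGraph.card_neighborFinset_eq_degree] at h8
    rw [Finset.card_univ] at h7
    omega
  have hH1 : ∀ x ∈ H, dH x ≤ H.card - 1 := by
    intro x hx
    rw [← Finset.card_erase_of_mem hx]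
    refine Finset.card_le_card ?_
    intro y hy
    simp only [Finset.mem_filter] at hy
    exact Finset.mem_erase.mpr ⟨hy.2.ne', hy.1⟩
  have B3 : ∑ x ∈ H, dH x ≤ H.card * 3 := by
    simpa using Finset.sum_le_card_nsmul H dH 3 (fun x _ => h3 x)
  have B1 : ∑ x ∈ H, dH x ≤ H.card * (H.card - 1) := by
    simpa using Finset.sum_le_card_nsmul H dH (H.card - 1) hH1
  have Bn : ∑ x ∈ H, G.degree x ≤ H.card * (Fintype.card V - 1) := by
    simpa using Finset.sum_le_card_nsmul H (fun x => G.degree x) (Fintype.card V - 1)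
      (fun x _ => by have := G.degree_lt_card_verts x; omega)
  by_cases hbig : 5 ≤ H.card
  · omega
  by_cases hfour : H.card = 4
  · by_cases hx : ∃ x ∈ H, 5 ≤ G.degree x
    · obtain ⟨x, hxH, hx⟩ := hx
      have e1 := Finset.add_sum_erase H dH hxH
      have e2 : ∑ y ∈ H.erase x, dH y ≤ _ :=
        Finset.sum_le_card_nsmul (H.erase x) dH 3 (fun x _ => h3 x)
      rw [Finset.card_erase_of_mem hxH, hfour] at e2
      have := h5 x hx
      simp at e2
      omega
    · push Not at hx
      have B4 : ∑ x ∈ H, G.degree x ≤ H.card * 4 := by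
        simpa using Finset.sum_le_card_nsmul H (fun x => G.degree x) 4
          (fun x hxH => by have := hx x hxH; omega)
      omega
  have hlt : H.card < 4 := by omega
  generalize H.card = k at *
  interval_cases k <;> omega

lemma sum_bound (hF : ¬ ContainsCopy doubleStar22Star G) (hG : G.Connected)
    (hn : 7 ≤ Fintype.card V) :
    ∑ x, G.degree x + 5 ≤ 4 * Fintype.card V := by
  by_cases h : ∃ u v a b c d, IsDD G u v a b c d
  · obtain ⟨u, v, a, b, c, d, h⟩ := h
    have := case_DD G hF hG hn h
    omega
  · push Not at h
    exact case_noDD G h hG hn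

end helpers

lemma edge_bound {n : ℕ} (hn : 7 ≤ n) (G : SimpleGraph (Fin n)) (hG : G.Connected)
    (hF : ¬ ContainsCopy doubleStar22Star G) : G.edgeSet.ncard ≤ 2 * n - 3 := by
  classical
  have h1 := sum_bound G hF hG (by simpa using hn)
  rw [G.sum_degrees_eq_twice_card_edges] at h1
  rw [← SimpleGraph.coe_edgeFinset, Set.ncard_coe_finset]
  simp at h1
  omega

/-- The extremal graph: `K_2` joined to an independent set. -/
def extremalGraph (n : ℕ) : SimpleGraph (Fin n) where
  Adj x y := x ≠ y ∧ (x.val < 2 ∨ y.val < 2)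
  symm := ⟨fun x y h => ⟨h.1.symm, h.2.symm⟩⟩
  loopless := ⟨fun x h => h.1 rfl⟩

lemma extremal_connected {n : ℕ} (hn : 7 ≤ n) : (extremalGraph n).Connected := by
  have : Nonempty (Fin n) := ⟨⟨0, by omega⟩⟩
  have key : ∀ x : Fin n, (extremalGraph n).Reachable ⟨0, by omega⟩ x := by
    intro x
    by_cases h : x = ⟨0, by omega⟩
    · rw [h]
    · exact SimpleGraph.Adj.reachable ⟨fun h' => h h'.symm, Or.inl (by simp)⟩
  exact ⟨fun x y => (key x).symm.trans (key y)⟩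

lemma extremal_free (n : ℕ) : ¬ ContainsCopy doubleStar22Star (extremalGraph n) := by
  rintro ⟨f, hf⟩
  have h1 := (hf (a := 0) (b := 3) (by simp [doubleStar22Star])).2
  have h2 := (hf (a := 1) (b := 4) (by simp [doubleStar22Star])).2
  have h3 := (hf (a := 2) (b := 6) (by simp [doubleStar22Star])).2
  have inj : ∀ i j, i ≠ j → (f i).val ≠ (f j).val := fun i j hij h =>
    hij (f.injective (Fin.ext h))
  have a1 := inj 0 1 (by decide)
  have a2 := inj 0 4 (by decide)
  have a3 := inj 0 2 (by decide)
  have a4 := inj 0 6 (by decide)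
  have a5 := inj 3 1 (by decide)
  have a6 := inj 3 4 (by decide)
  have a7 := inj 3 2 (by decide)
  have a8 := inj 3 6 (by decide)
  have b1 := inj 1 2 (by decide)
  have b2 := inj 1 6 (by decide)
  have b3 := inj 4 2 (by decide)
  have b4 := inj 4 6 (by decide)
  omega

lemma extremal_edges {n : ℕ} (hn : 7 ≤ n) : 2 * n - 3 ≤ (extremalGraph n).edgeSet.ncard := by
  classical
  have h1 := (extremalGraph n).sum_degrees_eq_twice_card_edges
  rw [← SimpleGraph.coe_edgeFinset, Set.ncard_coe_finset]
  have hle : ∀ x : Fin n, 2 + (if x = ⟨0, by omega⟩ then n - 3 else 0)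
      + (if x = ⟨1, by omega⟩ then n - 3 else 0) ≤ (extremalGraph n).degree x := by
    intro x
    rw [← SimpleGraph.card_neighborFinset_eq_degree]
    by_cases hx : x.val < 2
    · have : (Finset.univ.erase x) ⊆ (extremalGraph n).neighborFinset x := by
        intro y hy
        rw [SimpleGraph.mem_neighborFinset]
        exact ⟨(Finset.ne_of_mem_erase hy).symm, Or.inl hx⟩
      have := Finset.card_le_card this
      rw [Finset.card_erase_of_mem (Finset.mem_univ _), Finset.card_univ, Fintype.card_fin] at this
      have : ¬ (x.val = 0 ∧ x.val = 1) := by omega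
      simp only [Fin.ext_iff]
      split_ifs <;> omega
    · have : ({⟨0, by omega⟩, ⟨1, by omega⟩} : Finset (Fin n)) ⊆
          (extremalGraph n).neighborFinset x := by
        intro y hy
        rw [SimpleGraph.mem_neighborFinset]
        simp only [Finset.mem_insert, Finset.mem_singleton, Fin.ext_iff] at hy
        refine ⟨fun h => ?_, Or.inr (by omega)⟩
        have := congrArg Fin.val h
        omega
      have := Finset.card_le_card this
      rw [Finset.card_pair (by simp)] at this
      simp only [Fin.ext_iff]
      split_ifs <;> omega
  have h2 := Finset.sum_le_sum (fun x (_ : x ∈ Finset.univ) => hle x)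
  simp only [Finset.sum_add_distrib, Finset.sum_ite_eq', Finset.mem_univ, if_true,
    Finset.sum_const, Finset.card_univ, Fintype.card_fin, smul_eq_mul] at h2
  omega

theorem exConn_doubleStar22Star :
    (∀ n : ℕ, 7 ≤ n → exConn n doubleStar22Star = 2 * n - 3) ∧
    (∀ n : ℕ, 1 ≤ n → n ≤ 6 → exConn n doubleStar22Star = n.choose 2) := by
  constructor
  · intro n hn
    refine IsGreatest.csSup_eq ⟨⟨extremalGraph n, extremal_connected hn, extremal_free n, ?_⟩, ?_⟩
    · exact le_antisymm (extremal_edges hn)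
        (edge_bound hn _ (extremal_connected hn) (extremal_free n))
    · rintro m ⟨G, hG, hF, rfl⟩
      exact edge_bound hn G hG hF
  · intro n h1 h6
    have : Nonempty (Fin n) := ⟨⟨0, by omega⟩⟩
    refine IsGreatest.csSup_eq ⟨⟨⊤, SimpleGraph.connected_top, ?_, ?_⟩, ?_⟩
    · rintro ⟨f, -⟩
      have := Fintype.card_le_of_embedding f
      simp at this
      omega
    · classical
      rw [← SimpleGraph.coe_edgeFinset, Set.ncard_coe_finset,
        SimpleGraph.card_edgeFinset_top_eq_card_choose_two, Fintype.card_fin]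
    · rintro m ⟨G, hG, hF, rfl⟩
      classical
      rw [← SimpleGraph.coe_edgeFinset, Set.ncard_coe_finset]
      simpa using G.card_edgeFinset_le_card_choose_two
end

section
/- Let S_{2,2,2} be the spider on 7 vertices with three legs of two edges each. Then ex_c(n, S_{2,2,2}) = 2n − 2 for all n ≥ 7, and ex_c(n, S_{2,2,2}) = C(n,2) for all 1 ≤ n ≤ 6, where C(n,2) denotes the binomial coefficient n choose 2. -/
open SimpleGraph

/-- The spider `S_{2,2,2}` on 7 vertices: center `0` and three legs `0-1-2`, `0-3-4`,
`0-5-6` of two edges each. -/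
def spider222 : SimpleGraph (Fin 7) :=
  SimpleGraph.fromRel (fun i j =>
    (i = 0 ∧ j = 1) ∨ (i = 1 ∧ j = 2) ∨ (i = 0 ∧ j = 3) ∨ (i = 3 ∧ j = 4) ∨
    (i = 0 ∧ j = 5) ∨ (i = 5 ∧ j = 6))

/-! ### Basic facts on spiders -/

/-- No spider centred anywhere, written out on vertices. -/
def SpF {V : Type} (G : SimpleGraph V) : Prop :=
  ∀ c a b d e f g : V, [c, a, b, d, e, f, g].Nodup → G.Adj c a → G.Adj a b → G.Adj c d →
    G.Adj d e → G.Adj c f → G.Adj f g → False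

theorem spF_of_free {V : Type} {G : SimpleGraph V} (h : ¬ ContainsCopy spider222 G) : SpF G := by
  intro c a b d e f g hn h1 h2 h3 h4 h5 h6
  apply h
  refine ⟨⟨fun i => [c, a, b, d, e, f, g].get i, ?_⟩, ?_⟩
  · exact List.nodup_iff_injective_get.mp hn
  · intro i j hij
    simp only [spider222, SimpleGraph.fromRel_adj] at hij
    obtain ⟨_, h | h⟩ := hij
    · rcases h with ⟨rfl, rfl⟩ | ⟨rfl, rfl⟩ | ⟨rfl, rfl⟩ | ⟨rfl, rfl⟩ | ⟨rfl, rfl⟩ | ⟨rfl, rfl⟩ <;>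
        assumption
    · rcases h with ⟨rfl, rfl⟩ | ⟨rfl, rfl⟩ | ⟨rfl, rfl⟩ | ⟨rfl, rfl⟩ | ⟨rfl, rfl⟩ | ⟨rfl, rfl⟩ <;>
        (apply SimpleGraph.Adj.symm; assumption)

theorem free_induce {V : Type} {G : SimpleGraph V} (h : ¬ ContainsCopy spider222 G) (s : Set V) :
    ¬ ContainsCopy spider222 (G.induce s) := by
  rintro ⟨f, hf⟩
  exact h ⟨f.trans (Function.Embedding.subtype _), fun a b hab => hf hab⟩

/-- Counting edges: inside `s`, or in the explicit finite set `F`. -/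
theorem edge_count_s18 {V : Type} [Fintype V] (G : SimpleGraph V) (s : Set V) (F : Finset (Sym2 V))
    (h : ∀ a b, G.Adj a b → (a ∈ s ∧ b ∈ s) ∨ s(a, b) ∈ F) :
    G.edgeSet.ncard ≤ (G.induce s).edgeSet.ncard + F.card := by
  classical
  have hsub : G.edgeSet ⊆ (Sym2.map (Subtype.val : s → V)) '' (G.induce s).edgeSet ∪ (F : Set (Sym2 V)) := by
    intro x hx
    induction x using Sym2.ind with
    | _ a b =>
      rcases h a b hx with ⟨ha, hb⟩ | hF
      · left
        exact ⟨s(⟨a, ha⟩, ⟨b, hb⟩), hx, rfl⟩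
      · right; exact hF
  calc G.edgeSet.ncard ≤ _ := Set.ncard_le_ncard hsub (Set.toFinite _)
    _ ≤ _ := Set.ncard_union_le _ _
    _ ≤ _ := by
      rw [Set.ncard_coe_finset]
      exact Nat.add_le_add_right (Set.ncard_image_le (Set.toFinite _)) _

theorem edge_le_choose {V : Type} [Fintype V] (G : SimpleGraph V) :
    G.edgeSet.ncard ≤ (Fintype.card V).choose 2 := by
  classical
  rw [← SimpleGraph.coe_edgeFinset, Set.ncard_coe_finset]
  exact SimpleGraph.card_edgeFinset_le_card_choose_two

theorem conn_induce {V : Type} {G : SimpleGraph V} (hG : G.Connected) (s : Set V) (r : V → s)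
    (hr : ∀ x : s, r x = x)
    (ha : ∀ a b, G.Adj a b → (G.induce s).Reachable (r a) (r b)) : (G.induce s).Connected := by
  have key : ∀ a b, G.Walk a b → (G.induce s).Reachable (r a) (r b) := by
    intro a b w
    induction w with
    | nil => exact SimpleGraph.Reachable.refl _
    | cons h _ ih => exact (ha _ _ h).trans ih
  have : Nonempty s := ⟨r hG.nonempty.some⟩
  refine SimpleGraph.Connected.mk ?_
  intro x y
  obtain ⟨w⟩ := hG.preconnected x y
  simpa [hr] using key _ _ w

theorem exists_boundary {V : Type} {G : SimpleGraph V} (hG : G.Connected) (S : Set V) (a b : V)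
    (ha : a ∈ S) (hb : b ∉ S) : ∃ x y, x ∈ S ∧ y ∉ S ∧ G.Adj x y := by
  obtain ⟨w⟩ := hG.preconnected a b
  obtain ⟨d, _, h1, h2⟩ := w.exists_boundary_dart S ha hb
  exact ⟨d.fst, d.snd, h1, h2, d.adj⟩

/-! ### Hamiltonian cycles -/

theorem ham_bound {V : Type} [Fintype V] {G : SimpleGraph V} (hS : SpF G) (n : ℕ) (hn : 7 ≤ n)
    (c : ℕ → V) (hc : ∀ i j, c i = c j ↔ i ≡ j [MOD n]) (hsurj : ∀ v, ∃ i, i < n ∧ c i = v)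
    (hadj : ∀ i, G.Adj (c i) (c (i + 1))) : G.edgeSet.ncard ≤ 2 * n - 2 := by
  classical
  have hne : ∀ i a b, a < n → b < n → a ≠ b → c (i + a) ≠ c (i + b) := by
    intro i a b ha hb hab h
    rw [hc] at h
    have := Nat.ModEq.add_left_cancel' i h
    exact hab (Nat.ModEq.eq_of_lt_of_lt this ha hb)
  have hper : ∀ i, c (i + n) = c i := by
    intro i; rw [hc]; simp
  have hsp : ∀ i a1 a2 a3 a4 a5 a6, a1 < n → a2 < n → a3 < n → a4 < n → a5 < n → a6 < n →
      [0, a1, a2, a3, a4, a5, a6].Nodup → G.Adj (c i) (c (i + a1)) →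
      G.Adj (c (i + a1)) (c (i + a2)) → G.Adj (c i) (c (i + a3)) →
      G.Adj (c (i + a3)) (c (i + a4)) → G.Adj (c i) (c (i + a5)) →
      G.Adj (c (i + a5)) (c (i + a6)) → False := by
    intro i a1 a2 a3 a4 a5 a6 l1 l2 l3 l4 l5 l6 hnd
    apply hS
    have : [c i, c (i + a1), c (i + a2), c (i + a3), c (i + a4), c (i + a5), c (i + a6)] =
      [0, a1, a2, a3, a4, a5, a6].map (fun a => c (i + a)) := by simp
    rw [this]
    refine List.Nodup.map_on ?_ hnd
    intro x hx y hy hxy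
    by_contra hh
    refine hne i x y ?_ ?_ hh hxy
    · simp at hx; omega
    · simp at hy; omega
  have back1 : ∀ i, G.Adj (c i) (c (i + (n - 1))) := by
    intro i
    have := hadj (i + (n - 1))
    rw [show i + (n - 1) + 1 = i + n by omega, hper] at this
    exact this.symm
  have step : ∀ i a b, b = a + 1 → G.Adj (c (i + a)) (c (i + b)) := by
    intro i a b h; subst h; exact hadj _
  have chord : ∀ i d, 3 ≤ d → d ≤ n - 3 → ¬ G.Adj (c i) (c (i + d)) := by
    intro i d h3 hd h
    by_cases hd4 : d = 3
    · subst hd4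
      refine hsp i 1 2 (n-1) (n-2) 3 4 (by omega) (by omega) (by omega) (by omega) (by omega)
        (by omega) ?_ (hadj i) (step _ _ _ rfl) (back1 i) (step _ _ _ (by omega)).symm h
        (step _ _ _ rfl)
      simp; omega
    · refine hsp i 1 2 (n-1) (n-2) d (d-1) (by omega) (by omega) (by omega) (by omega) (by omega)
        (by omega) ?_ (hadj i) (step _ _ _ rfl) (back1 i) (step _ _ _ (by omega)).symm h
        (step _ _ _ (by omega)).symm
      simp; omega
  have three : ∀ i, ∃ m, i ≤ m ∧ m ≤ i + 2 ∧ ¬ G.Adj (c m) (c (m + 2)) := by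
    intro i
    by_contra hcon
    push Not at hcon
    have h0 := hcon i (by omega) (by omega)
    have h1 := hcon (i+1) (by omega) (by omega)
    have h2 := hcon (i+2) (by omega) (by omega)
    refine hsp i 1 3 2 4 (n-1) (n-2) (by omega) (by omega) (by omega) (by omega) (by omega)
        (by omega) ?_ (hadj i) h1 h0 h2 (back1 i) (step _ _ _ (by omega)).symm
    simp; omega
  obtain ⟨m1, hm1, hm1', hm1a⟩ := three 0
  obtain ⟨m2, hm2, hm2', hm2a⟩ := three 3
  have cov : ∀ i d, i < n → d < n → G.Adj (c i) (c (i + d)) →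
      s(c i, c (i + d)) ∈ (Finset.range n).image (fun i => s(c i, c (i + 1))) ∪
      (((Finset.range n).erase m1).erase m2).image (fun i => s(c i, c (i + 2))) := by
    intro i d hi hd h
    have d0 : d ≠ 0 := by rintro rfl; exact G.irrefl h
    have hmodr : ∀ j, c (j % n) = c j := by
      intro j; rw [hc]; exact Nat.mod_modEq _ _
    have hmodr2 : ∀ j k, c (j % n + k) = c (j + k) := by
      intro j k; rw [hc]; exact (Nat.mod_modEq _ _).add_right _
    have one : ∀ j, s(c j, c (j + 1)) ∈ (Finset.range n).image (fun i => s(c i, c (i + 1))) := by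
      intro j
      refine Finset.mem_image.mpr ⟨j % n, Finset.mem_range.mpr (Nat.mod_lt _ (by omega)), ?_⟩
      simp only [hmodr, hmodr2]
    have two : ∀ j, G.Adj (c j) (c (j + 2)) → s(c j, c (j + 2)) ∈
        (((Finset.range n).erase m1).erase m2).image (fun i => s(c i, c (i + 2))) := by
      intro j hj
      refine Finset.mem_image.mpr ⟨j % n, ?_, ?_⟩
      · refine Finset.mem_erase.mpr ⟨?_, Finset.mem_erase.mpr
          ⟨?_, Finset.mem_range.mpr (Nat.mod_lt _ (by omega))⟩⟩
        · intro hh; apply hm2a; rw [← hh, hmodr, hmodr2]; exact hj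
        · intro hh; apply hm1a; rw [← hh, hmodr, hmodr2]; exact hj
      · simp only [hmodr, hmodr2]
    rw [Finset.mem_union]
    by_cases e1 : d = 1
    · subst e1; exact Or.inl (one i)
    by_cases e2 : d = 2
    · subst e2; exact Or.inr (two i h)
    by_cases e3 : d = n - 1
    · left
      have := one (i + d)
      rw [show i + d + 1 = i + n by omega, hper, Sym2.eq_swap] at this
      exact this
    by_cases e4 : d = n - 2
    · right
      have := two (i + d)
      rw [show i + d + 2 = i + n by omega, hper, Sym2.eq_swap] at this
      exact this h.symm
    exact absurd h (chord i d (by omega) (by omega))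
  have hsub : G.edgeSet ⊆ (((Finset.range n).image (fun i => s(c i, c (i + 1))) ∪
      (((Finset.range n).erase m1).erase m2).image (fun i => s(c i, c (i + 2))) :
      Finset (Sym2 V)) : Set (Sym2 V)) := by
    intro x hx
    induction x using Sym2.ind with
    | _ a b =>
      obtain ⟨i, hi, rfl⟩ := hsurj a
      obtain ⟨j, hj, rfl⟩ := hsurj b
      have hx' : G.Adj (c i) (c j) := hx
      by_cases hij : i ≤ j
      · have := cov i (j - i) hi (by omega)
        rw [show i + (j - i) = j by omega] at this
        exact this hx'
      · have := cov j (i - j) hj (by omega)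
        rw [show j + (i - j) = i by omega, Sym2.eq_swap] at this
        exact this hx'.symm
  refine (Set.ncard_le_ncard hsub (Set.toFinite _)).trans ?_
  rw [Set.ncard_coe_finset]
  refine (Finset.card_union_le _ _).trans ?_
  have c1 := Finset.card_image_le (s := Finset.range n) (f := fun i => s(c i, c (i + 1)))
  have c2 := Finset.card_image_le (s := ((Finset.range n).erase m1).erase m2)
    (f := fun i => s(c i, c (i + 2)))
  rw [Finset.card_erase_of_mem, Finset.card_erase_of_mem] at c2
  · simp at c1 c2; omega
  · simp; omega
  · simp; omega
/-! ### The base case: seven vertices, one of degree at most two -/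

/-- Code of the edge `ij` of a graph on `{0,…,6}`. -/
def eCode (i j : ℕ) : ℕ := 7 * min i j + max i j

/-- Twenty-one spiders `c; a, 6; d, e; f, g`, listed as `(c, a, d, e, f, g)`. -/
def spiders : List (ℕ × ℕ × ℕ × ℕ × ℕ × ℕ) :=
  [(1, 0, 2, 3, 4, 5), (2, 0, 4, 3, 5, 1), (3, 0, 1, 4, 5, 2), (5, 0, 3, 1, 4, 2),
   (4, 0, 1, 5, 3, 2), (3, 0, 1, 2, 4, 5), (1, 0, 2, 4, 5, 3), (0, 1, 4, 3, 5, 2),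
   (2, 1, 0, 4, 3, 5), (5, 1, 0, 3, 4, 2), (2, 0, 3, 1, 5, 4), (5, 0, 2, 1, 3, 4),
   (4, 1, 0, 2, 5, 3), (3, 1, 0, 5, 2, 4), (4, 0, 1, 3, 2, 5), (1, 0, 3, 2, 5, 4),
   (5, 0, 1, 4, 2, 3), (2, 1, 0, 5, 4, 3), (2, 0, 3, 5, 4, 1), (5, 1, 0, 2, 3, 4),
   (2, 0, 1, 3, 5, 4)]

/-- The set of edges of a listed spider, as a bit mask. -/
def spMask : ℕ × ℕ × ℕ × ℕ × ℕ × ℕ → ℕ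
  | (c, a, d, e, f, g) => 2 ^ eCode c a ||| 2 ^ eCode a 6 ||| 2 ^ eCode c d ||| 2 ^ eCode d e |||
      2 ^ eCode c f ||| 2 ^ eCode f g

/-- The masks of the listed spiders. -/
def masks : List ℕ :=
  [8590068290, 34345028, 67636296, 8657306720, 33691728, 8623490632, 67375682, 34086962, 67248660,
   8590209064, 8590591044, 101188192, 8657053716, 402472, 789584, 8590070850, 661600, 33825316,
   67504196, 100675620, 8590460484]

theorem masks_eq : masks = spiders.map spMask := by decide +kernel

theorem spiders_nodup : ∀ t ∈ spiders, [t.1, t.2.1, 6, t.2.2.1, t.2.2.2.1, t.2.2.2.2.1,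
    t.2.2.2.2.2].Nodup ∧ t.1 < 7 ∧ t.2.1 < 7 ∧ t.2.2.1 < 7 ∧ t.2.2.2.1 < 7 ∧ t.2.2.2.2.1 < 7 ∧
    t.2.2.2.2.2 < 7 := by decide +kernel

/-- One of the listed spiders is contained in the graph with edge mask `P`. -/
def hasSp (P : ℕ) : Bool := masks.any fun m => Nat.beq (Nat.land P m) m

/-- Every way to delete at most `k` of the listed edges leaves a spider. -/
def srch : List ℕ → ℕ → ℕ → Bool
  | [], P, _ => hasSp P
  | e :: es, P, k => srch es (P ||| 2 ^ e) k && (k == 0 || srch es P (k - 1))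

/-- Codes of the edges other than `06`: the edge `16` and those inside `{0,…,5}`. -/
def edgeCodes : List ℕ :=
  [13, 1, 2, 3, 4, 5, 9, 10, 11, 12, 17, 18, 19, 25, 26, 33]

set_option maxRecDepth 100000 in
theorem srch_ok : srch edgeCodes (2 ^ 6) 4 = true := by
  decide +kernel

theorem hasSp_sound {V : Type} {G : SimpleGraph V} (hS : SpF G) (v : ℕ → V)
    (hv : ∀ i j, i < 7 → j < 7 → v i = v j → i = j) (P : ℕ)
    (hP : ∀ k, P.testBit k = true → G.Adj (v (k / 7)) (v (k % 7))) : hasSp P = false := by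
  by_contra hh
  rw [Bool.not_eq_false] at hh
  simp only [hasSp, List.any_eq_true, masks_eq, List.mem_map] at hh
  obtain ⟨m, ⟨⟨c, a, d, e, f, g⟩, ht, rfl⟩, hm⟩ := hh
  have hm' : P &&& spMask (c, a, d, e, f, g) = spMask (c, a, d, e, f, g) := Nat.eq_of_beq_eq_true hm
  obtain ⟨hnd, lc, la, ld, le, lf, lg⟩ := spiders_nodup _ ht
  simp only at hnd lc la ld le lf lg
  have hadj : ∀ i j, i < 7 → j < 7 → (spMask (c, a, d, e, f, g)).testBit (eCode i j) = true →
      G.Adj (v i) (v j) := by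
    intro i j hi hj h
    rw [← hm', Nat.testBit_and, Bool.and_eq_true] at h
    have := hP _ h.1
    unfold eCode at this
    rcases le_total i j with hij | hij
    · rw [min_eq_left hij, max_eq_right hij, show (7 * i + j) / 7 = i by omega,
        show (7 * i + j) % 7 = j by omega] at this
      exact this
    · rw [min_eq_right hij, max_eq_left hij, show (7 * j + i) / 7 = j by omega,
        show (7 * j + i) % 7 = i by omega] at this
      exact this.symm
  refine hS (v c) (v a) (v 6) (v d) (v e) (v f) (v g) ?_
    (hadj _ _ lc la (by simp [spMask])) (hadj _ _ la (by omega) (by simp [spMask]))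
    (hadj _ _ lc ld (by simp [spMask])) (hadj _ _ ld le (by simp [spMask]))
    (hadj _ _ lc lf (by simp [spMask])) (hadj _ _ lf lg (by simp [spMask]))
  have : [v c, v a, v 6, v d, v e, v f, v g] = [c, a, 6, d, e, f, g].map v := by simp
  rw [this]
  refine List.Nodup.map_on ?_ ?_
  · intro x hx y hy hxy
    refine hv x y ?_ ?_ hxy
    · simp at hx; omega
    · simp at hy; omega
  · exact hnd

open Classical in
theorem srch_sound {V : Type} {G : SimpleGraph V} (hS : SpF G) (v : ℕ → V)
    (hv : ∀ i j, i < 7 → j < 7 → v i = v j → i = j) (es : List ℕ) : ∀ (P k : ℕ),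
    (∀ k, P.testBit k = true → G.Adj (v (k / 7)) (v (k % 7))) →
    es.countP (fun e => decide (¬ G.Adj (v (e / 7)) (v (e % 7)))) ≤ k → srch es P k = false := by
  induction es with
  | nil => intro P k hP _; exact hasSp_sound hS v hv P hP
  | cons e es ih =>
    intro P k hP hk
    simp only [srch, Bool.and_eq_false_iff, Bool.or_eq_false_iff]
    rw [List.countP_cons] at hk
    by_cases h : G.Adj (v (e / 7)) (v (e % 7))
    · left
      simp only [h, not_true_eq_false, decide_false, Bool.false_eq_true, if_false, add_zero] at hk
      refine ih _ _ ?_ hk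
      intro j hj
      rw [Nat.testBit_or, Nat.testBit_two_pow, Bool.or_eq_true] at hj
      rcases hj with hj | hj
      · exact hP j hj
      · have : e = j := by simpa using hj
        subst this; exact h
    · right
      simp only [h, not_false_eq_true, decide_true, if_true] at hk
      refine ⟨by simp; omega, ih _ _ hP (by omega)⟩

theorem base7 {V : Type} [Fintype V] {G : SimpleGraph V} (hV : Fintype.card V = 7) (hS : SpF G)
    (x a b : V) (hxa : G.Adj x a) (hN : ∀ w, G.Adj x w → w = a ∨ w = b) :
    G.edgeSet.ncard ≤ 12 := by
  classical
  obtain ⟨b', hbx, hba, hN'⟩ : ∃ b', b' ≠ x ∧ b' ≠ a ∧ ∀ w, G.Adj x w → w = a ∨ w = b' := by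
    by_cases hb : b ≠ x ∧ b ≠ a
    · exact ⟨b, hb.1, hb.2, hN⟩
    · obtain ⟨b', hb2⟩ := Finset.exists_mem_notMem_of_card_lt_card
        (s := ({x, a} : Finset V)) (t := Finset.univ)
        (lt_of_le_of_lt Finset.card_le_two (by rw [Finset.card_univ]; omega))
      simp at hb2
      refine ⟨b', hb2.1, hb2.2, fun w hw => Or.inl ?_⟩
      rcases hN w hw with h | h
      · exact h
      · subst h
        by_contra hwa
        exact hb ⟨hw.ne', hwa⟩
  clear hN
  obtain ⟨v, hv, hsurj, hv6, hv0, hv1⟩ : ∃ v : ℕ → V, (∀ i j, i < 7 → j < 7 → v i = v j → i = j) ∧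
      (∀ w, ∃ i, i < 7 ∧ v i = w) ∧ v 6 = x ∧ v 0 = a ∧ v 1 = b' := by
    have hinj : Function.Injective ![a, b', x] := by
      have := hxa.ne
      intro i j hij
      fin_cases i <;> fin_cases j <;> simp_all
    obtain ⟨e0⟩ : Nonempty (Fin 7 ≃ V) := ⟨(Fintype.equivFinOfCardEq hV).symm⟩
    have hinj2 : Function.Injective (![0, 1, 6] : Fin 3 → Fin 7) := by decide
    obtain ⟨σ, hσ⟩ := Equiv.Perm.exists_extending_pair (![0, 1, 6] : Fin 3 → Fin 7)
      (e0.symm ∘ ![a, b', x]) hinj2 (e0.symm.injective.comp hinj)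
    refine ⟨fun i => e0 (σ (Fin.ofNat 7 i)), ?_, ?_, ?_, ?_, ?_⟩
    · intro i j hi hj h
      have := σ.injective (e0.injective h)
      have := congrArg Fin.val this
      simpa [Fin.ofNat, Nat.mod_eq_of_lt hi, Nat.mod_eq_of_lt hj] using this
    · intro w
      refine ⟨(σ.symm (e0.symm w)).val, Fin.isLt _, ?_⟩
      simp
    · have := hσ 2
      simp at this
      simp [Fin.ofNat]
      exact e0.symm_apply_eq.mp this.symm |>.symm ▸ rfl
    · have := hσ 0
      simp at this
      simp [Fin.ofNat]
      exact e0.symm_apply_eq.mp this.symm |>.symm ▸ rfl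
    · have := hσ 1
      simp at this
      simp [Fin.ofNat]
      exact e0.symm_apply_eq.mp this.symm |>.symm ▸ rfl
  by_contra hcard
  have hcode : (∀ k, (2 ^ 6).testBit k = true → G.Adj (v (k / 7)) (v (k % 7))) := by
    intro k hk
    rw [Nat.testBit_two_pow] at hk
    have : 6 = k := by simpa using hk
    subst this
    simpa [hv6, hv0] using hxa.symm
  have h1 := srch_ok
  rw [srch_sound hS v hv edgeCodes (2 ^ 6) 4 hcode] at h1
  · exact Bool.noConfusion h1
  · set F : Finset (Sym2 V) := insert s(v 0, v 6) ((edgeCodes.toFinset.filter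
      (fun e => G.Adj (v (e / 7)) (v (e % 7)))).image (fun e => s(v (e / 7), v (e % 7)))) with hF
    have hsub : G.edgeSet ⊆ (F : Set (Sym2 V)) := by
      have key : ∀ i j, i < 7 → j < 7 → i < j → G.Adj (v i) (v j) → s(v i, v j) ∈ F := by
        intro i j hi hj hij h
        by_cases h06 : i = 0 ∧ j = 6
        · rw [hF, h06.1, h06.2]; exact Finset.mem_insert_self _ _
        · refine Finset.mem_insert_of_mem (Finset.mem_image.mpr ⟨7 * i + j, ?_, ?_⟩)
          · rw [Finset.mem_filter, show (7 * i + j) / 7 = i by omega,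
              show (7 * i + j) % 7 = j by omega]
            refine ⟨?_, h⟩
            by_cases hj6 : j = 6
            · subst hj6
              have h' := hN' (v i) (hv6 ▸ h.symm)
              rw [← hv0, ← hv1] at h'
              have : i = 1 := by
                rcases h' with h' | h'
                · have := hv _ _ hi (by omega) h'; omega
                · exact hv _ _ hi (by omega) h'
              subst this
              decide
            · have hj' : j < 6 := by omega
              clear * - hij hj'
              interval_cases j <;> interval_cases i <;> decide
          · rw [show (7 * i + j) / 7 = i by omega, show (7 * i + j) % 7 = j by omega]
      intro y hy
      induction y using Sym2.ind with
      | _ p q =>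
        obtain ⟨i, hi, rfl⟩ := hsurj p
        obtain ⟨j, hj, rfl⟩ := hsurj q
        have hy' : G.Adj (v i) (v j) := hy
        have hij : i ≠ j := by rintro rfl; exact G.irrefl hy'
        rcases lt_or_gt_of_ne hij with h | h
        · exact key i j hi hj h hy'
        · rw [Sym2.eq_swap]; exact key j i hj hi h hy'.symm
    have hc := Set.ncard_le_ncard hsub (Set.toFinite _)
    rw [Set.ncard_coe_finset] at hc
    have hc2 : F.card ≤ _ := Finset.card_insert_le _ _
    have hc3 := Finset.card_image_le (s := edgeCodes.toFinset.filter
      (fun e => G.Adj (v (e / 7)) (v (e % 7)))) (f := fun e => s(v (e / 7), v (e % 7)))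
    have hnd : edgeCodes.Nodup := by decide
    have hc4 : (edgeCodes.toFinset.filter (fun e => G.Adj (v (e / 7)) (v (e % 7)))).card =
        edgeCodes.countP (fun e => decide (G.Adj (v (e / 7)) (v (e % 7)))) := by
      rw [List.countP_eq_length_filter, ← List.toFinset_card_of_nodup (hnd.filter _)]
      congr 1
      ext e
      simp
    have hlen : edgeCodes.length = 16 := rfl
    have hc5 := List.length_eq_countP_add_countP
      (fun e => decide (G.Adj (v (e / 7)) (v (e % 7)))) (l := edgeCodes)
    simp only [decide_eq_true_eq] at hc5 ⊢
    omega
/-! ### Longest paths -/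

/-- `q 0, …, q l` is a path with `l` edges. -/
def IsP {V : Type} (G : SimpleGraph V) (q : ℕ → V) (l : ℕ) : Prop :=
  (∀ i j, i ≤ l → j ≤ l → q i = q j → i = j) ∧ ∀ i, i < l → G.Adj (q i) (q (i + 1))

theorem exists_longest {V : Type} [Fintype V] (G : SimpleGraph V) (x : V) :
    ∃ l, (∃ q, IsP G q l) ∧ ∀ q, ¬ IsP G q (l + 1) := by
  by_contra hcon
  push Not at hcon
  have hall : ∀ l, ∃ q, IsP G q l := by
    intro l
    induction l with
    | zero => exact ⟨fun _ => x, fun i j hi hj _ => by omega, fun i hi => by omega⟩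
    | succ l ih => exact hcon l ih
  obtain ⟨q, hq⟩ := hall (Fintype.card V)
  have : Function.Injective (fun i : Fin (Fintype.card V + 1) => q i) := by
    intro i j hij
    exact Fin.ext (hq.1 i j (by omega) (by omega) hij)
  have := Fintype.card_le_of_injective _ this
  simp at this

theorem isP_rev {V : Type} {G : SimpleGraph V} {q : ℕ → V} {l : ℕ} (h : IsP G q l) :
    IsP G (fun k => q (l - k)) l := by
  refine ⟨fun i j hi hj hij => ?_, fun i hi => ?_⟩
  · have := h.1 _ _ (by omega) (by omega) hij
    omega
  · have := h.2 (l - (i + 1)) (by omega)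
    rw [show l - (i + 1) + 1 = l - i by omega] at this
    exact this.symm

theorem isP_nbr {V : Type} {G : SimpleGraph V} {q : ℕ → V} {l : ℕ} (h : IsP G q l)
    (hmax : ∀ q, ¬ IsP G q (l + 1)) (w : V) (hw : G.Adj (q 0) w) :
    ∃ i, 1 ≤ i ∧ i ≤ l ∧ w = q i := by
  by_contra hcon
  push Not at hcon
  have hcon' : ∀ i, i ≤ l → w ≠ q i := by
    intro i hi
    rcases Nat.eq_zero_or_pos i with rfl | h0
    · exact hw.ne'
    · exact hcon i h0 hi
  apply hmax (fun k => if k = 0 then w else q (k - 1))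
  refine ⟨fun i j hi hj hij => ?_, fun i hi => ?_⟩
  · simp only at hij
    split_ifs at hij with h1 h2 h2
    · omega
    · exact absurd hij (hcon' _ (by omega))
    · exact absurd hij.symm (hcon' _ (by omega))
    · have := h.1 _ _ (by omega) (by omega) hij
      omega
  · rcases Nat.eq_zero_or_pos i with rfl | h0
    · simpa using hw.symm
    · have := h.2 (i - 1) (by omega)
      rw [show i - 1 + 1 = i by omega] at this
      simpa [show i ≠ 0 by omega] using this

theorem closed_bound {V : Type} [Fintype V] {G : SimpleGraph V} (hG : G.Connected) (hS : SpF G)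
    (hV : 7 ≤ Fintype.card V) {q : ℕ → V} {l : ℕ} (h : IsP G q l)
    (hmax : ∀ q, ¬ IsP G q (l + 1)) (hcl : G.Adj (q 0) (q l)) :
    G.edgeSet.ncard ≤ 2 * Fintype.card V - 2 := by
  classical
  have hl : 0 < l := by
    rcases Nat.eq_zero_or_pos l with rfl | h0
    · exact absurd hcl (G.irrefl)
    · exact h0
  have hlt : ∀ i, i % (l + 1) < l + 1 := fun i => Nat.mod_lt _ (by omega)
  set c : ℕ → V := fun i => q (i % (l + 1)) with hcdef
  have hc : ∀ i j, c i = c j ↔ i ≡ j [MOD (l + 1)] := by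
    intro i j
    constructor
    · intro hij
      exact h.1 _ _ (Nat.le_of_lt_succ (hlt i)) (Nat.le_of_lt_succ (hlt j)) hij
    · intro hij
      exact congrArg q hij
  have hadj : ∀ i, G.Adj (c i) (c (i + 1)) := by
    intro i
    have h1 := hlt i
    simp only [hcdef]
    rw [Nat.add_mod i 1, Nat.mod_eq_of_lt (show 1 < l + 1 by omega)]
    by_cases hi : i % (l + 1) = l
    · rw [hi, Nat.mod_self]; exact hcl.symm
    · rw [Nat.mod_eq_of_lt (show i % (l + 1) + 1 < l + 1 by omega)]
      exact h.2 _ (by omega)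
  have hsurj : ∀ v, ∃ i, i < l + 1 ∧ c i = v := by
    intro v
    by_contra hv
    obtain ⟨x, y, ⟨i, hi⟩, hy, hxy⟩ := exists_boundary hG (Set.range c) (c 0) v ⟨0, rfl⟩ (by
      rintro ⟨i, hi⟩
      refine hv ⟨i % (l + 1), hlt i, ?_⟩
      rw [← hi, hc]; exact Nat.mod_modEq _ _)
    subst hi
    have hy' : ∀ j, y ≠ c j := fun j hj => hy ⟨j, hj.symm⟩
    apply hmax (fun k => if k = 0 then y else c (i + (k - 1)))
    refine ⟨fun a b ha hb hab => ?_, fun a ha => ?_⟩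
    · simp only at hab
      split_ifs at hab with h1 h2 h2
      · omega
      · exact absurd hab (hy' _)
      · exact absurd hab.symm (hy' _)
      · rw [hc] at hab
        have := Nat.ModEq.eq_of_lt_of_lt (Nat.ModEq.add_left_cancel' i hab) (by omega) (by omega)
        omega
    · rcases Nat.eq_zero_or_pos a with rfl | h0
      · simpa using hxy.symm
      · have := hadj (i + (a - 1))
        rw [show i + (a - 1) + 1 = i + a by omega] at this
        simpa [show a ≠ 0 by omega] using this
  have hcard : l + 1 = Fintype.card V := by
    have : Function.Bijective (fun i : Fin (l + 1) => q i) := by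
      constructor
      · intro i j hij
        exact Fin.ext (h.1 i j (by omega) (by omega) hij)
      · intro v
        obtain ⟨i, hi, hv⟩ := hsurj v
        refine ⟨⟨i, hi⟩, ?_⟩
        simpa [hcdef, Nat.mod_eq_of_lt hi] using hv
    simpa using Fintype.card_of_bijective this
  rw [← hcard]
  exact ham_bound hS (l + 1) (by omega) c hc hsurj hadj

theorem isP_spider {V : Type} {G : SimpleGraph V} (hS : SpF G) {q : ℕ → V} {l : ℕ}
    (h : IsP G q l) (a0 a1 a2 a3 a4 a5 a6 : ℕ)
    (hle : a0 ≤ l ∧ a1 ≤ l ∧ a2 ≤ l ∧ a3 ≤ l ∧ a4 ≤ l ∧ a5 ≤ l ∧ a6 ≤ l)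
    (hnd : [a0, a1, a2, a3, a4, a5, a6].Nodup)
    (h1 : G.Adj (q a0) (q a1)) (h2 : G.Adj (q a1) (q a2)) (h3 : G.Adj (q a0) (q a3))
    (h4 : G.Adj (q a3) (q a4)) (h5 : G.Adj (q a0) (q a5)) (h6 : G.Adj (q a5) (q a6)) : False := by
  refine hS _ _ _ _ _ _ _ ?_ h1 h2 h3 h4 h5 h6
  have : [q a0, q a1, q a2, q a3, q a4, q a5, q a6] = [a0, a1, a2, a3, a4, a5, a6].map q := by simp
  rw [this]
  refine List.Nodup.map_on ?_ hnd
  intro x hx y hy hxy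
  refine h.1 x y ?_ ?_ hxy
  · simp at hx; omega
  · simp at hy; omega

/-- Neighbours of the end of a longest path are among the next three vertices. -/
theorem nbr_le_three {V : Type} {G : SimpleGraph V} (hS : SpF G) {l : ℕ}
    (hNP : ∀ q, IsP G q l → ∀ w, G.Adj (q 0) w → ∃ i, 1 ≤ i ∧ i ≤ l ∧ w = q i)
    (hNH : ∀ q, IsP G q l → ¬ G.Adj (q 0) (q l))
    (hD : ∀ q, IsP G q l → ∀ a b, ∃ w, G.Adj (q 0) w ∧ w ≠ a ∧ w ≠ b)
    {q : ℕ → V} (h : IsP G q l) (j : ℕ) (hj : j ≤ l) (hqj : G.Adj (q 0) (q j)) : j ≤ 3 := by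
  by_contra hj3
  have hjl : j ≠ l := by rintro rfl; exact hNH q h hqj
  have st : ∀ a b, b = a + 1 → b ≤ l → G.Adj (q a) (q b) := by
    intro a b hab hb; subst hab; exact h.2 a (by omega)
  -- neighbours of the other end
  have hend : ∀ a b, ∃ m, m < l ∧ 0 < m ∧ G.Adj (q l) (q m) ∧ m ≠ a ∧ m ≠ b := by
    intro a b
    obtain ⟨w, hw, hwa, hwb⟩ := hD _ (isP_rev h) (q a) (q b)
    obtain ⟨i, hi1, hi2, rfl⟩ := hNP _ (isP_rev h) w hw
    simp only [Nat.sub_zero] at hw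
    refine ⟨l - i, by omega, ?_, hw, ?_, ?_⟩
    · by_contra h0
      rw [show l - i = 0 by omega] at hw
      exact hNH q h hw.symm
    · rintro rfl; exact hwa rfl
    · rintro rfl; exact hwb rfl
  by_cases hj4 : j = 4
  · subst hj4
    have h01 := st 0 1 rfl (by omega)
    have h12 := st 1 2 rfl (by omega)
    have h23 := st 2 3 rfl (by omega)
    have h34 := st 3 4 rfl (by omega)
    have h45 := st 4 5 rfl (by omega)
    by_cases hl5 : l = 5
    · subst hl5
      have no3 : ¬ G.Adj (q 5) (q 3) := by
        intro h53
        refine hNH (fun k => q ([5, 4, 0, 1, 2, 3].getD k 0)) ⟨?_, ?_⟩ (by simpa using h53)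
        · intro a b ha hb hab
          interval_cases a <;> interval_cases b <;> first | rfl | (exact absurd (h.1 _ _ (by simp) (by simp) hab) (by simp))
        · intro a ha
          interval_cases a
          · exact h45.symm
          · exact hqj.symm
          · exact h01
          · exact h12
          · exact h23
      obtain ⟨m, hm1, hm2, hm3, hm4, hm5⟩ := hend 4 1
      obtain ⟨m', hm1', hm2', hm3', hm4', hm5'⟩ := hend 4 2
      have e : m = 2 := by
        have : m ≠ 3 := by rintro rfl; exact no3 hm3
        omega
      have e' : m' = 1 := by
        have : m' ≠ 3 := by rintro rfl; exact no3 hm3'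
        omega
      subst e e'
      refine hNH (fun k => q ([5, 2, 3, 4, 0, 1].getD k 0)) ⟨?_, ?_⟩ (by simpa using hm3')
      · intro a b ha hb hab
        interval_cases a <;> interval_cases b <;> first | rfl | (exact absurd (h.1 _ _ (by simp) (by simp) hab) (by simp))
      · intro a ha
        interval_cases a
        · exact hm3
        · exact h23
        · exact h34
        · exact hqj.symm
        · exact h01
    · exact isP_spider hS h 4 0 1 3 2 5 6 (by omega) (by simp) hqj.symm h01 h34.symm h23.symm
        h45 (st 5 6 rfl (by omega))
  · have hj5 : 5 ≤ j := by omega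
    -- `j = l - 1`
    have hjl1 : j = l - 1 := by
      by_contra hne
      exact isP_spider hS h j 0 1 (j-1) (j-2) (j+1) (j+2) (by omega) (by simp; omega) hqj.symm
        (st _ _ rfl (by omega)) (st _ _ (by omega) (by omega)).symm
        (st _ _ (by omega) (by omega)).symm (st _ _ (by omega) (by omega))
        (st _ _ (by omega) (by omega))
    -- `q 0 ~ q 2`
    have h02 : G.Adj (q 0) (q 2) := by
      obtain ⟨w, hw, hwa, hwb⟩ := hD _ h (q 1) (q j)
      obtain ⟨i, hi1, hi2, rfl⟩ := hNP _ h w hw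
      have i1 : i ≠ 1 := by rintro rfl; exact hwa rfl
      have ij : i ≠ j := by rintro rfl; exact hwb rfl
      have il : i ≠ l := by rintro rfl; exact hNH q h hw
      by_cases i2 : i = 2
      · subst i2; exact hw
      exfalso
      by_cases i3 : i = 3
      · subst i3
        exact isP_spider hS h 0 1 2 3 4 j (j+1) (by omega) (by simp; omega)
          (st _ _ (by omega) (by omega)) (st _ _ (by omega) (by omega)) hw
          (st _ _ (by omega) (by omega)) hqj (st _ _ (by omega) (by omega))
      · exact isP_spider hS h 0 1 2 i (i-1) j (j+1) (by omega) (by simp; omega)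
          (st _ _ (by omega) (by omega)) (st _ _ (by omega) (by omega)) hw
          (st _ _ (by omega) (by omega)).symm hqj (st _ _ (by omega) (by omega))
    obtain ⟨m, hm1, hm2, hm3, hm4, hm5⟩ := hend (l-1) (l-3)
    by_cases hm : m = l - 2
    · subst hm
      refine hNH (fun k => q (if k = 0 then l else if k = 1 then l - 1 else k - 2)) ⟨?_, ?_⟩ ?_
      · intro a b ha hb hab
        have := h.1 _ _ (by split_ifs <;> omega) (by split_ifs <;> omega) hab
        split_ifs at this <;> omega
      · intro a ha
        rcases Nat.lt_or_ge a 2 with h2 | h2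
        · interval_cases a
          · exact (st _ _ (by simp; omega) (by simp)).symm
          · simp only [one_ne_zero, if_false, if_true]
            rw [← hjl1]; exact hqj.symm
        · have := st (a - 2) (a + 1 - 2) (by omega) (by omega)
          simpa [show a ≠ 0 by omega, show a ≠ 1 by omega] using this
      · simpa [show l ≠ 0 by omega, show l ≠ 1 by omega] using hm3
    · subst hjl1
      by_cases hm1 : m = 1
      · subst hm1
        exact isP_spider hS h (l-1) l 1 (l-2) (l-3) 0 2 (by omega) (by simp; omega)
          (st _ _ (by omega) (by omega)) hm3 (st _ _ (by omega) (by omega)).symm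
          (st _ _ (by omega) (by omega)).symm hqj.symm h02
      · exact isP_spider hS h (l-1) l m (l-2) (l-3) 0 1 (by omega) (by simp; omega)
          (st _ _ (by omega) (by omega)) hm3 (st _ _ (by omega) (by omega)).symm
          (st _ _ (by omega) (by omega)).symm hqj.symm (st _ _ (by omega) (by omega))

/-- The end of a longest path lies in a pendant `K₄`. -/
theorem pendant_K4 {V : Type} {G : SimpleGraph V} (hS : SpF G) {l : ℕ}
    (hNP : ∀ q, IsP G q l → ∀ w, G.Adj (q 0) w → ∃ i, 1 ≤ i ∧ i ≤ l ∧ w = q i)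
    (hNH : ∀ q, IsP G q l → ¬ G.Adj (q 0) (q l))
    (hD : ∀ q, IsP G q l → ∀ a b, ∃ w, G.Adj (q 0) w ∧ w ≠ a ∧ w ≠ b)
    {q : ℕ → V} (h : IsP G q l) : 4 ≤ l ∧ G.Adj (q 0) (q 3) ∧
      ∀ i, i < 3 → ∀ w, G.Adj (q i) w → ∃ k, k ≤ 3 ∧ w = q k := by
  have N : ∀ r, IsP G r l → ∀ w, G.Adj (r 0) w → ∃ i, 1 ≤ i ∧ i ≤ l ∧ i ≤ 3 ∧ w = r i := by
    intro r hr w hw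
    obtain ⟨i, h1, h2, rfl⟩ := hNP r hr w hw
    exact ⟨i, h1, h2, nbr_le_three hS hNP hNH hD hr i h2 hw, rfl⟩
  have A3 : l ≥ 3 ∧ G.Adj (q 0) (q 3) := by
    obtain ⟨w, hw, hwa, hwb⟩ := hD _ h (q 1) (q 2)
    obtain ⟨i, h1, h2, h3, rfl⟩ := N q h w hw
    have i1 : i ≠ 1 := by rintro rfl; exact hwa rfl
    have i2 : i ≠ 2 := by rintro rfl; exact hwb rfl
    have : i = 3 := by omega
    subst this
    exact ⟨h2, hw⟩
  have A2 : G.Adj (q 0) (q 2) := by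
    obtain ⟨w, hw, hwa, hwb⟩ := hD _ h (q 1) (q 3)
    obtain ⟨i, h1, h2, h3, rfl⟩ := N q h w hw
    have i1 : i ≠ 1 := by rintro rfl; exact hwa rfl
    have i2 : i ≠ 3 := by rintro rfl; exact hwb rfl
    have : i = 2 := by omega
    subst this
    exact hw
  have hl : 4 ≤ l := by
    have : l ≠ 3 := by rintro rfl; exact hNH q h A3.2
    omega
  refine ⟨hl, A3.2, ?_⟩
  have P1 : IsP G (fun k => q (if k = 0 then 1 else if k = 1 then 0 else k)) l := by
    refine ⟨?_, ?_⟩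
    · intro a b ha hb hab
      have := h.1 _ _ (by split_ifs <;> omega) (by split_ifs <;> omega) hab
      split_ifs at this <;> omega
    · intro a ha
      rcases Nat.lt_or_ge a 2 with h2 | h2
      · interval_cases a
        · exact (h.2 0 (by omega)).symm
        · exact A2
      · simpa [show a ≠ 0 by omega, show a ≠ 1 by omega] using h.2 a ha
  have P2 : IsP G (fun k => q (if k = 0 then 2 else if k = 2 then 0 else k)) l := by
    refine ⟨?_, ?_⟩
    · intro a b ha hb hab
      have := h.1 _ _ (by split_ifs <;> omega) (by split_ifs <;> omega) hab
      split_ifs at this <;> omega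
    · intro a ha
      rcases Nat.lt_or_ge a 3 with h2 | h2
      · interval_cases a
        · exact (h.2 1 (by omega)).symm
        · exact (h.2 0 (by omega)).symm
        · exact A3.2
      · simpa [show a ≠ 0 by omega, show a ≠ 2 by omega, show a ≠ 1 by omega] using h.2 a ha
  intro i hi w hw
  interval_cases i
  · obtain ⟨i, _, _, h3, rfl⟩ := N q h w hw
    exact ⟨i, h3, rfl⟩
  · obtain ⟨i, _, _, h3, rfl⟩ := N _ P1 w hw
    exact ⟨_, by split_ifs <;> omega, rfl⟩
  · obtain ⟨i, _, _, h3, rfl⟩ := N _ P2 w hw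
    exact ⟨_, by split_ifs <;> omega, rfl⟩
/-! ### The upper bound -/

open Classical in
theorem card_notin {V : Type} [Fintype V] (T : Finset V) :
    Fintype.card {x : V | x ∉ T} = Fintype.card V - T.card := by
  have : Fintype.card {x : V | x ∉ T} = (Tᶜ).card := by
    rw [Fintype.card_ofFinset]
    congr 1
    ext x; simp
  rw [this, Finset.card_compl]

open Classical in
theorem upper_bound (n : ℕ) : 7 ≤ n → ∀ (V : Type) [Fintype V] (G : SimpleGraph V),
    Fintype.card V = n → G.Connected → ¬ ContainsCopy spider222 G →
    G.edgeSet.ncard ≤ 2 * n - 2 := by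
  induction n using Nat.strong_induction_on with
  | _ n ih =>
  intro hn V _ G hV hG hfree
  by_contra hbig
  have hS := spF_of_free hfree
  obtain ⟨x0⟩ := hG.nonempty
  obtain ⟨l, ⟨p, hp⟩, hmax⟩ := exists_longest G x0
  have hNP : ∀ q, IsP G q l → ∀ w, G.Adj (q 0) w → ∃ i, 1 ≤ i ∧ i ≤ l ∧ w = q i :=
    fun q hq w hw => isP_nbr hq hmax w hw
  have hNH : ∀ q, IsP G q l → ¬ G.Adj (q 0) (q l) := by
    intro q hq hcl
    have := closed_bound hG hS (by omega) hq hmax hcl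
    omega
  have hnb : ∀ x, ∃ w, G.Adj x w := by
    intro x
    have : Nontrivial V := Fintype.one_lt_card_iff_nontrivial.mp (by omega)
    obtain ⟨y, hy⟩ := exists_ne x
    obtain ⟨a, b, rfl, _, hab⟩ := exists_boundary hG {x} x y rfl hy
    exact ⟨b, hab⟩
  have hD : ∀ q, IsP G q l → ∀ a b, ∃ w, G.Adj (q 0) w ∧ w ≠ a ∧ w ≠ b := by
    intro q hq a b
    by_contra hcon
    have hN : ∀ w, G.Adj (q 0) w → w = a ∨ w = b := by
      intro w hw
      by_contra hh
      push Not at hh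
      exact hcon ⟨w, hw, hh.1, hh.2⟩
    obtain ⟨w, hw⟩ := hnb (q 0)
    by_cases h7 : n = 7
    · have : G.edgeSet.ncard ≤ 12 := by
        rcases hN w hw with rfl | rfl
        · exact base7 (by omega) hS (q 0) w b hw hN
        · exact base7 (by omega) hS (q 0) w a hw (fun y hy => (hN y hy).symm)
      omega
    · obtain ⟨i, hi1, hi2, _⟩ := hNP q hq w hw
      have hl : 1 ≤ l := by omega
      have hq0 : ∀ i, 1 ≤ i → i ≤ l → q i ∉ ({q 0} : Finset V) := by
        intro i h1 h2 h3
        have := hq.1 _ _ h2 (by omega) (Finset.mem_singleton.mp h3)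
        omega
      set s : Set V := {x | x ∉ ({q 0} : Finset V)} with hs
      have hreach : ∀ i (h1 : 1 ≤ i) (h2 : i ≤ l), (G.induce s).Reachable
          ⟨q 1, hq0 1 le_rfl hl⟩ ⟨q i, hq0 i h1 h2⟩ := by
        intro i h1
        induction i, h1 using Nat.le_induction with
        | base => intro _; exact SimpleGraph.Reachable.refl _
        | succ i h1 ihh =>
          intro h2
          refine (ihh (by omega)).trans (SimpleGraph.Adj.reachable ?_)
          exact hq.2 i (by omega)
      have hconn : (G.induce s).Connected := by
        refine conn_induce hG s
          (fun x => if hx : x ∈ s then ⟨x, hx⟩ else ⟨q 1, hq0 1 le_rfl hl⟩) ?_ ?_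
        · intro x; simp [x.2]
        · intro y z hyz
          have out : ∀ y, y ∉ s → y = q 0 := by
            intro y hy; simpa [hs] using hy
          by_cases hy : y ∈ s <;> by_cases hz : z ∈ s
          · simp only [hy, hz, dif_pos]
            exact SimpleGraph.Adj.reachable hyz
          · simp only [hy, hz, dif_pos, dif_neg, not_false_eq_true]
            rw [out z hz] at hyz
            obtain ⟨i, h1, h2, rfl⟩ := hNP q hq y hyz.symm
            exact (hreach i h1 h2).symm
          · simp only [hy, hz, dif_pos, dif_neg, not_false_eq_true]
            rw [out y hy] at hyz
            obtain ⟨i, h1, h2, rfl⟩ := hNP q hq z hyz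
            exact hreach i h1 h2
          · rw [out y hy, out z hz] at hyz
            exact absurd hyz G.irrefl
      have hcs : Fintype.card s = n - 1 := by
        rw [card_notin, hV]; simp
      have h1 := ih (n - 1) (by omega) (by omega) s (G.induce s) hcs hconn (free_induce hfree s)
      have h2 := edge_count_s18 G s {s(q 0, a), s(q 0, b)} (by
        intro y z hyz
        by_cases hy : y = q 0
        · right
          subst hy
          rcases hN z hyz with rfl | rfl <;> simp
        · by_cases hz : z = q 0
          · right
            subst hz
            rw [Sym2.eq_swap]
            rcases hN y hyz.symm with rfl | rfl <;> simp
          · left; simp [hs, hy, hz])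
      have h3 : ({s(q 0, a), s(q 0, b)} : Finset (Sym2 V)).card ≤ 2 := Finset.card_le_two
      omega
  -- the two pendant `K₄`s
  have K : ∀ q, IsP G q l → ∀ y z, G.Adj y z → (y ∈ ({q 0, q 1, q 2} : Finset V)) →
      s(y, z) ∈ ({s(q 0, q 1), s(q 0, q 2), s(q 0, q 3), s(q 1, q 2), s(q 1, q 3), s(q 2, q 3)} :
        Finset (Sym2 V)) := by
    intro q hq y z hyz hy
    obtain ⟨_, _, hK⟩ := pendant_K4 hS hNP hNH hD hq
    have hi : ∃ i, i < 3 ∧ y = q i := by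
      simp only [Finset.mem_insert, Finset.mem_singleton] at hy
      rcases hy with h | h | h
      · exact ⟨0, by omega, h⟩
      · exact ⟨1, by omega, h⟩
      · exact ⟨2, by omega, h⟩
    obtain ⟨i, hi, rfl⟩ := hi
    obtain ⟨k, hk, rfl⟩ := hK i hi z hyz
    have hik : i ≠ k := by rintro rfl; exact G.irrefl hyz
    clear hyz hy hbig
    interval_cases i <;> interval_cases k <;> first | (exact absurd rfl hik) | simp
  have cardF : ∀ q : ℕ → V, ({s(q 0, q 1), s(q 0, q 2), s(q 0, q 3), s(q 1, q 2), s(q 1, q 3),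
      s(q 2, q 3)} : Finset (Sym2 V)).card ≤ 6 := fun q => Finset.card_le_six
  have cardT : ∀ q, IsP G q l → ({q 0, q 1, q 2} : Finset V).card = 3 := by
    intro q hq
    have hl := (pendant_K4 hS hNP hNH hD hq).1
    rw [Finset.card_eq_three]
    refine ⟨_, _, _, ?_, ?_, ?_, rfl⟩ <;>
    · intro hh
      have := hq.1 _ _ (by omega) (by omega) hh
      omega
  obtain ⟨hl4, h03, hKp⟩ := pendant_K4 hS hNP hNH hD hp
  have hr := isP_rev hp
  obtain ⟨_, h03r, hKr⟩ := pendant_K4 hS hNP hNH hD hr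
  have hl6 : 6 ≤ l := by
    by_contra hl
    simp only [Nat.sub_zero] at h03r
    obtain ⟨k, hk, hk2⟩ := hKp (l - 3) (by omega) _ h03r.symm
    have := hp.1 _ _ le_rfl (by omega) hk2
    omega
  by_cases h10 : 10 ≤ n
  · set T : Finset V := {p 0, p 1, p 2} with hT
    set s : Set V := {x | x ∉ T} with hs
    have h3s : p 3 ∈ s := by
      intro h3
      simp only [hT, Finset.mem_insert, Finset.mem_singleton] at h3
      rcases h3 with h | h | h <;>
      · have := hp.1 _ _ (by omega) (by omega) h
        omega
    have hnbT : ∀ y z, G.Adj y z → y ∈ T → z ∈ s → z = p 3 := by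
      intro y z hyz hy hz
      have hi : ∃ i, i < 3 ∧ y = p i := by
        simp only [hT, Finset.mem_insert, Finset.mem_singleton] at hy
        rcases hy with h | h | h
        · exact ⟨0, by omega, h⟩
        · exact ⟨1, by omega, h⟩
        · exact ⟨2, by omega, h⟩
      obtain ⟨i, hi, rfl⟩ := hi
      obtain ⟨k, hk, rfl⟩ := hKp i hi z hyz
      by_cases hk3 : k = 3
      · rw [hk3]
      · exfalso
        apply hz
        have : k < 3 := by omega
        interval_cases k <;> simp [hT]
    have hconn : (G.induce s).Connected := by
      refine conn_induce hG s (fun x => if hx : x ∈ s then ⟨x, hx⟩ else ⟨p 3, h3s⟩) ?_ ?_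
      · intro x; simp [x.2]
      · intro y z hyz
        have out : ∀ y, y ∉ s → y ∈ T := fun y hy => not_not.mp hy
        by_cases hy : y ∈ s <;> by_cases hz : z ∈ s
        · simp only [hy, hz, dif_pos]
          exact SimpleGraph.Adj.reachable hyz
        · simp only [hy, hz, dif_pos, dif_neg, not_false_eq_true]
          have := hnbT z y hyz.symm (out z hz) hy
          subst this
          exact SimpleGraph.Reachable.refl _
        · simp only [hy, hz, dif_pos, dif_neg, not_false_eq_true]
          have := hnbT y z hyz (out y hy) hz
          subst this
          exact SimpleGraph.Reachable.refl _
        · simp only [hy, hz, dif_neg, not_false_eq_true]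
          exact SimpleGraph.Reachable.refl _
    have hcs : Fintype.card s = n - 3 := by
      rw [card_notin, hV, cardT p hp]
    have h1 := ih (n - 3) (by omega) (by omega) s (G.induce s) hcs hconn (free_induce hfree s)
    have h2 := edge_count_s18 G s _ (by
      intro y z hyz
      by_cases hy : y ∈ T
      · exact Or.inr (K p hp y z hyz hy)
      · by_cases hz : z ∈ T
        · right
          rw [show s(y, z) = s(z, y) from Sym2.eq_swap]
          exact K p hp z y hyz.symm hz
        · exact Or.inl ⟨hy, hz⟩)
    have h3 := cardF p
    omega
  · set r : ℕ → V := fun k => p (l - k) with hrdef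
    set T : Finset V := {p 0, p 1, p 2} ∪ {r 0, r 1, r 2} with hT
    set s : Set V := {x | x ∉ T} with hs
    have hdis : Disjoint ({p 0, p 1, p 2} : Finset V) {r 0, r 1, r 2} := by
      rw [Finset.disjoint_left]
      intro y hy hy'
      simp only [Finset.mem_insert, Finset.mem_singleton] at hy hy'
      rcases hy with rfl | rfl | rfl <;> rcases hy' with h | h | h <;>
      · have := hp.1 _ _ (by omega) (by omega) h
        omega
    have hcT : T.card = 6 := by
      rw [hT, Finset.card_union_of_disjoint hdis, cardT p hp, cardT r hr]
    have hcs : Fintype.card s = n - 6 := by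
      rw [card_notin, hV, hcT]
    have h1 := edge_le_choose (G.induce s)
    rw [hcs] at h1
    have key : ∀ y z, G.Adj y z → y ∈ T → s(y, z) ∈
        ({s(p 0, p 1), s(p 0, p 2), s(p 0, p 3), s(p 1, p 2), s(p 1, p 3), s(p 2, p 3)} :
          Finset (Sym2 V)) ∪
        ({s(r 0, r 1), s(r 0, r 2), s(r 0, r 3), s(r 1, r 2), s(r 1, r 3), s(r 2, r 3)} :
          Finset (Sym2 V)) := by
      intro y z hyz hy
      rcases Finset.mem_union.mp hy with h | h
      · exact Finset.mem_union_left _ (K p hp y z hyz h)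
      · exact Finset.mem_union_right _ (K r hr y z hyz h)
    have h2 := edge_count_s18 G s _ (by
      intro y z hyz
      by_cases hy : y ∈ T
      · exact Or.inr (key y z hyz hy)
      · by_cases hz : z ∈ T
        · right
          rw [show s(y, z) = s(z, y) from Sym2.eq_swap]
          exact key z y hyz.symm hz
        · exact Or.inl ⟨hy, hz⟩)
    have h3 := cardF p
    have h4 := cardF r
    have h5 := Finset.card_union_le
      ({s(p 0, p 1), s(p 0, p 2), s(p 0, p 3), s(p 1, p 2), s(p 1, p 3), s(p 2, p 3)} :
          Finset (Sym2 V))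
      ({s(r 0, r 1), s(r 0, r 2), s(r 0, r 3), s(r 1, r 2), s(r 1, r 3), s(r 2, r 3)} :
          Finset (Sym2 V))
    have h6 : (n - 6).choose 2 + 12 ≤ 2 * n - 2 := by
      have : n < 10 := by omega
      interval_cases n <;> decide
    omega

/-! ### The lower bound -/

/-- Two dominating vertices plus one further edge. -/
def exGraph (n : ℕ) : SimpleGraph (Fin n) where
  Adj i j := i ≠ j ∧ (i.val < 2 ∨ j.val < 2 ∨ (i.val < 4 ∧ j.val < 4))
  symm := ⟨by
    rintro i j ⟨h, h'⟩
    exact ⟨h.symm, by tauto⟩⟩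
  loopless := ⟨fun i h => h.1 rfl⟩

theorem exGraph_conn (n : ℕ) (hn : 7 ≤ n) : (exGraph n).Connected := by
  have hz : ∀ i : Fin n, (exGraph n).Reachable ⟨0, by omega⟩ i := by
    intro i
    by_cases hi : i = ⟨0, by omega⟩
    · rw [hi]
    · exact SimpleGraph.Adj.reachable ⟨fun h => hi h.symm, Or.inl (by simp)⟩
  have : Nonempty (Fin n) := ⟨⟨0, by omega⟩⟩
  exact SimpleGraph.Connected.mk fun i j => (hz i).symm.trans (hz j)

theorem exGraph_free (n : ℕ) : ¬ ContainsCopy spider222 (exGraph n) := by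
  rintro ⟨f, hf⟩
  have hne : ∀ i j : Fin 7, i ≠ j → (f i).val ≠ (f j).val := by
    intro i j hij h
    exact hij (f.injective (Fin.ext h))
  have h1 := (hf (show spider222.Adj 0 1 by simp [spider222])).2
  have h2 := (hf (show spider222.Adj 1 2 by simp [spider222])).2
  have h3 := (hf (show spider222.Adj 0 3 by simp [spider222])).2
  have h4 := (hf (show spider222.Adj 3 4 by simp [spider222])).2
  have h5 := (hf (show spider222.Adj 0 5 by simp [spider222])).2
  have h6 := (hf (show spider222.Adj 5 6 by simp [spider222])).2
  have n01 := hne 0 1 (by decide)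
  have n02 := hne 0 2 (by decide)
  have n03 := hne 0 3 (by decide)
  have n04 := hne 0 4 (by decide)
  have n05 := hne 0 5 (by decide)
  have n06 := hne 0 6 (by decide)
  have n12 := hne 1 2 (by decide)
  have n13 := hne 1 3 (by decide)
  have n14 := hne 1 4 (by decide)
  have n15 := hne 1 5 (by decide)
  have n16 := hne 1 6 (by decide)
  have n23 := hne 2 3 (by decide)
  have n24 := hne 2 4 (by decide)
  have n25 := hne 2 5 (by decide)
  have n26 := hne 2 6 (by decide)
  have n34 := hne 3 4 (by decide)
  have n35 := hne 3 5 (by decide)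
  have n36 := hne 3 6 (by decide)
  have n45 := hne 4 5 (by decide)
  have n46 := hne 4 6 (by decide)
  have n56 := hne 5 6 (by decide)
  generalize (f 0).val = x0 at *
  generalize (f 1).val = x1 at *
  generalize (f 2).val = x2 at *
  generalize (f 3).val = x3 at *
  generalize (f 4).val = x4 at *
  generalize (f 5).val = x5 at *
  generalize (f 6).val = x6 at *
  clear hf hne
  have leg : ∀ x y : ℕ, x ≠ y → (x < 2 ∨ y < 2 ∨ x < 4 ∧ y < 4) →
      ∃ m, m ≤ 2 ∧ (x = m ∨ y = m) ∧ (m = 2 → x = 3 ∨ y = 3) := by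
    intro x y hxy h
    refine ⟨min x y, ?_, ?_, ?_⟩ <;> omega
  obtain ⟨a, ha, ha', ha3⟩ := leg x1 x2 n12 h2
  obtain ⟨b, hb, hb', hb3⟩ := leg x3 x4 n34 h4
  obtain ⟨c, hc, hc', hc3⟩ := leg x5 x6 n56 h6
  have hab : a ≠ b := by
    clear * - ha' hb' n13 n14 n23 n24
    omega
  have hac : a ≠ c := by
    clear * - ha' hc' n15 n16 n25 n26
    omega
  have hbc : b ≠ c := by
    clear * - hb' hc' n35 n36 n45 n46
    omega
  have h0a : x0 ≠ a ∧ (a = 2 → x0 ≠ 3) := by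
    clear * - ha' ha3 n01 n02
    omega
  have h0b : x0 ≠ b ∧ (b = 2 → x0 ≠ 3) := by
    clear * - hb' hb3 n03 n04
    omega
  have h0c : x0 ≠ c ∧ (c = 2 → x0 ≠ 3) := by
    clear * - hc' hc3 n05 n06
    omega
  have hx0 : 4 ≤ x0 := by
    clear * - ha hb hc hab hac hbc h0a h0b h0c
    interval_cases a <;> interval_cases b <;> interval_cases c <;> omega
  clear * - hx0 h1 h3 h5 n13 n15 n35
  omega

theorem exGraph_edges (n : ℕ) (hn : 7 ≤ n) : 2 * n - 2 ≤ (exGraph n).edgeSet.ncard := by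
  classical
  let g : ℕ → Fin n := fun i => if h : i < n then ⟨i, h⟩ else ⟨0, by omega⟩
  have gv : ∀ i, i < n → (g i).val = i := fun i hi => by simp [g, hi]
  let e : ℕ → Sym2 (Fin n) := fun k =>
    if k < n - 1 then s(g 0, g (k + 1)) else
      if k < 2 * n - 3 then s(g 1, g (k + 3 - n)) else s(g 2, g 3)
  have hinj : Set.InjOn e (Finset.range (2 * n - 2)) := by
    intro a ha b hb hab
    simp only [Finset.coe_range, Set.mem_Iio] at ha hb
    have v0 := gv 0 (by omega)
    have v1 := gv 1 (by omega)
    have v2 := gv 2 (by omega)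
    have v3 := gv 3 (by omega)
    have w1 := gv (a + 1)
    have w2 := gv (a + 3 - n)
    have w3 := gv (b + 1)
    have w4 := gv (b + 3 - n)
    simp only [e] at hab
    split_ifs at hab with c1 c2 c3 c4 c5 c6 c7 c8 <;>
    simp only [Sym2.eq_iff, Fin.ext_iff] at hab
    all_goals omega
  have hsub : ((Finset.range (2 * n - 2)).image e : Set (Sym2 (Fin n))) ⊆ (exGraph n).edgeSet := by
    intro x hx
    simp only [Finset.coe_image, Set.mem_image, Finset.coe_range, Set.mem_Iio] at hx
    obtain ⟨k, hk, rfl⟩ := hx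
    have v0 := gv 0 (by omega)
    have v1 := gv 1 (by omega)
    have v2 := gv 2 (by omega)
    have v3 := gv 3 (by omega)
    simp only [e]
    split_ifs with h1 h2 <;> rw [SimpleGraph.mem_edgeSet]
    · have := gv (k + 1) (by omega)
      exact ⟨fun h => by have := congrArg Fin.val h; omega, by omega⟩
    · have := gv (k + 3 - n) (by omega)
      exact ⟨fun h => by have := congrArg Fin.val h; omega, by omega⟩
    · exact ⟨fun h => by have := congrArg Fin.val h; omega, by omega⟩
  have := Set.ncard_le_ncard hsub (Set.toFinite _)
  rw [Set.ncard_coe_finset, Finset.card_image_of_injOn hinj,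
    Finset.card_range] at this
  exact this

theorem exConn_eq (n m : ℕ)
    (hub : ∀ G : SimpleGraph (Fin n), G.Connected → ¬ ContainsCopy spider222 G →
      G.edgeSet.ncard ≤ m)
    (hlb : ∃ G : SimpleGraph (Fin n), G.Connected ∧ ¬ ContainsCopy spider222 G ∧
      m ≤ G.edgeSet.ncard) : exConn n spider222 = m := by
  obtain ⟨G, h1, h2, h3⟩ := hlb
  refine IsGreatest.csSup_eq ⟨⟨G, h1, h2, le_antisymm h3 (hub G h1 h2)⟩, ?_⟩
  rintro k ⟨H, hH1, hH2, rfl⟩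
  exact hub H hH1 hH2

/-- Theorem: `ex_c(n, S_{2,2,2}) = 2n - 2` for all `n ≥ 7`, and
`ex_c(n, S_{2,2,2}) = C(n,2)` for all `1 ≤ n ≤ 6`. -/
theorem exConn_spider222 :
    (∀ n : ℕ, 7 ≤ n → exConn n spider222 = 2 * n - 2) ∧
    (∀ n : ℕ, 1 ≤ n → n ≤ 6 → exConn n spider222 = n.choose 2) := by
  constructor
  · intro n hn
    refine exConn_eq n _ (fun G h1 h2 => upper_bound n hn (Fin n) G (by simp) h1 h2)
      ⟨exGraph n, exGraph_conn n hn, exGraph_free n, exGraph_edges n hn⟩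
  · intro n h1 h6
    have : Nonempty (Fin n) := ⟨⟨0, by omega⟩⟩
    refine exConn_eq n _ (fun G _ _ => by simpa using edge_le_choose G)
      ⟨⊤, SimpleGraph.connected_top, ?_, ?_⟩
    · rintro ⟨f, _⟩
      have := Fintype.card_le_of_embedding f
      simp at this
      omega
    · classical
      rw [← SimpleGraph.coe_edgeFinset, Set.ncard_coe_finset,
        SimpleGraph.card_edgeFinset_top_eq_card_choose_two]
      simp
end
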